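/- arXiv:2103.14309 — 2 statements merged into one kernel-verified Lean document; each statement's English description precedes it below -/
import Mathlib

section
/- The periodic shadowing property is generic in C_λ(I): there is a residual subset R of C_λ(I) such that every f ∈ R has the periodic shadowing property, i.e., for every ε > 0 there exists δ > 0 such that every periodic δ-pseudo orbit (y_n)_{n≥0} of f is ε-traced by some periodic point x of f. -/
open MeasureTheory Set Metric Filter Topology

noncomputable section

/-- Lebesgue measure on the unit interval `[0,1]`, viewed as a measure on the subtype. -/
def lebI : Measure unitInterval := (volume : Measure ℝ).comap Subtype.val

/-- A continuous self-map of `[0,1]` preserves Lebesgue measure. -/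
def MeasPres (f : C(unitInterval, unitInterval)) : Prop :=
  ∀ A : Set unitInterval, MeasurableSet A → lebI (f ⁻¹' A) = lebI A

/-- The space `C_λ(I)` of continuous Lebesgue-measure-preserving maps of `[0,1]`. -/
def CLam : Set C(unitInterval, unitInterval) := {f | MeasPres f}

/-- `Fix(f,k) = {x : f^k x = x}`. -/
def FixSet {X : Type*} (f : X → X) (k : ℕ) : Set X := {x | f^[k] x = x}

/-- `Per(f,k) = {x : f^k x = x and f^i x ≠ x for 1 ≤ i < k}`. -/
def PerSet {X : Type*} (f : X → X) (k : ℕ) : Set X :=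
  {x | f^[k] x = x ∧ ∀ i : ℕ, 1 ≤ i → i < k → f^[i] x ≠ x}

/-- `Per(f) = ⋃_{k ≥ 1} Fix(f,k)`, the set of all periodic points. -/
def PerAll {X : Type*} (f : X → X) : Set X := ⋃ k ∈ {k : ℕ | 1 ≤ k}, FixSet f k

/-- A Cantor set: nonempty, compact, perfect and totally disconnected. -/
def IsCantorSet {X : Type*} [TopologicalSpace X] (C : Set X) : Prop :=
  C.Nonempty ∧ IsCompact C ∧ Perfect C ∧ IsTotallyDisconnected C

/-- `y` is a `δ`-pseudo orbit of `f`. -/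
def IsPseudoOrbit (f : unitInterval → unitInterval) (δ : ℝ) (y : ℕ → unitInterval) : Prop :=
  ∀ n : ℕ, dist (f (y n)) (y (n + 1)) < δ

/-- The point `x` `ε`-traces the sequence `y`. -/
def Traces (f : unitInterval → unitInterval) (ε : ℝ) (x : unitInterval) (y : ℕ → unitInterval) :
    Prop :=
  ∀ n : ℕ, dist (f^[n] x) (y n) < ε

/-- The shadowing property. -/
def Shadowing (f : unitInterval → unitInterval) : Prop :=
  ∀ ε > (0 : ℝ), ∃ δ > (0 : ℝ), ∀ y : ℕ → unitInterval,
    IsPseudoOrbit f δ y → ∃ x : unitInterval, Traces f ε x y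

/-- A sequence is periodic (with some period `N ≥ 1`). -/
def PeriodicSeq (y : ℕ → unitInterval) : Prop :=
  ∃ N : ℕ, 1 ≤ N ∧ ∀ n : ℕ, y (n + N) = y n

/-- `x` is a periodic point of `f`. -/
def IsPeriodicPt' (f : unitInterval → unitInterval) (x : unitInterval) : Prop :=
  ∃ N : ℕ, 1 ≤ N ∧ f^[N] x = x

/-- The periodic shadowing property. -/
def PeriodicShadowing (f : unitInterval → unitInterval) : Prop :=
  ∀ ε > (0 : ℝ), ∃ δ > (0 : ℝ), ∀ y : ℕ → unitInterval,
    IsPseudoOrbit f δ y → PeriodicSeq y →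
      ∃ x : unitInterval, IsPeriodicPt' f x ∧ Traces f ε x y

theorem exists_uIcc_mapsTo_Icc {h : ℝ → ℝ} (hc : Continuous h) {x y p q : ℝ}
    (hx : h x = p) (hy : h y = q) (hpq : p ≤ q) :
    ∃ u ∈ uIcc x y, ∃ v ∈ uIcc x y, h u = p ∧ h v = q ∧ ∀ w ∈ uIcc u v, h w ∈ Icc p q := by
  have hK : IsCompact (((uIcc x y) ∩ h ⁻¹' {p}) ×ˢ ((uIcc x y) ∩ h ⁻¹' {q})) :=
    (isCompact_uIcc.inter_right (isClosed_singleton.preimage hc)).prod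
      (isCompact_uIcc.inter_right (isClosed_singleton.preimage hc))
  obtain ⟨⟨u, v⟩, ⟨⟨hu, hup⟩, hv, hvq⟩, hmin⟩ :=
    hK.exists_isMinOn (f := fun z : ℝ × ℝ => |z.1 - z.2|)
      ⟨(x, y), ⟨left_mem_uIcc, hx⟩, right_mem_uIcc, hy⟩ (by fun_prop)
  simp only [mem_preimage, mem_singleton_iff] at hup hvq
  refine ⟨u, hu, v, hv, hup, hvq, fun w hw => ?_⟩
  have huv : uIcc u v ⊆ uIcc x y := uIcc_subset_uIcc hu hv
  by_contra hcon
  rw [mem_Icc, not_and_or, not_le, not_le] at hcon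
  rcases hcon with hlt | hgt
  · obtain ⟨w', hw', hw'p⟩ := intermediate_value_uIcc (a := w) (b := v) hc.continuousOn
      (show p ∈ uIcc (h w) (h v) by rw [hvq]; exact mem_uIcc.2 (Or.inl ⟨hlt.le, hpq⟩))
    have hle := hmin (show (w', v) ∈ _ from
      ⟨⟨huv (uIcc_subset_uIcc hw right_mem_uIcc hw'), hw'p⟩, hv, hvq⟩)
    simp only [mem_ofPred_eq] at hle
    have hne : w' ≠ w := by rintro rfl; linarith
    have hwu : w ≠ u := by rintro rfl; linarith
    rcases mem_uIcc.1 hw with ⟨h1, h2⟩ | ⟨h1, h2⟩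
    · rw [uIcc_of_le h2] at hw'
      have := lt_of_le_of_ne hw'.1 hne.symm
      have := hw'.2
      rw [abs_of_nonpos (by linarith), abs_of_nonpos (by linarith)] at hle
      linarith
    · rw [uIcc_of_ge h1] at hw'
      have := lt_of_le_of_ne hw'.2 hne
      have := hw'.1
      rw [abs_of_nonneg (by linarith), abs_of_nonneg (by linarith)] at hle
      linarith
  · obtain ⟨w', hw', hw'p⟩ := intermediate_value_uIcc (a := u) (b := w) hc.continuousOn
      (show q ∈ uIcc (h u) (h w) by rw [hup]; exact mem_uIcc.2 (Or.inl ⟨hpq, hgt.le⟩))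
    have hle := hmin (show (u, w') ∈ _ from
      ⟨⟨hu, hup⟩, huv (uIcc_subset_uIcc left_mem_uIcc hw hw'), hw'p⟩)
    simp only [mem_ofPred_eq] at hle
    have hne : w' ≠ w := by rintro rfl; linarith
    rcases mem_uIcc.1 hw with ⟨h1, h2⟩ | ⟨h1, h2⟩
    · rw [uIcc_of_le h1] at hw'
      have := lt_of_le_of_ne hw'.2 hne
      have := hw'.1
      rw [abs_of_nonpos (by linarith), abs_of_nonpos (by linarith)] at hle
      linarith
    · rw [uIcc_of_ge h2] at hw'
      have := lt_of_le_of_ne hw'.1 hne.symm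
      have := hw'.2
      rw [abs_of_nonneg (by linarith), abs_of_nonneg (by linarith)] at hle
      linarith

theorem exists_uIcc_iterate_mem_Icc {G : ℝ → ℝ} (hG : Continuous G) {a b : ℕ → ℝ}
    (hab : ∀ n, a n ≤ b n)
    (hcov : ∀ n, Icc (a (n + 1)) (b (n + 1)) ⊆ G '' Icc (a n) (b n)) (n : ℕ) :
    ∃ u v, G^[n] u = a n ∧ G^[n] v = b n ∧
      ∀ w ∈ uIcc u v, ∀ k ≤ n, G^[k] w ∈ Icc (a k) (b k) := by
  induction n with
  | zero =>
    refine ⟨a 0, b 0, rfl, rfl, fun w hw k hk => ?_⟩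
    obtain rfl : k = 0 := by omega
    simpa [uIcc_of_le (hab 0)] using hw
  | succ n ih =>
    obtain ⟨u, v, hu, hv, hw⟩ := ih
    have hlift : ∀ z ∈ Icc (a (n + 1)) (b (n + 1)), ∃ x ∈ uIcc u v, G^[n + 1] x = z := by
      intro z hz
      obtain ⟨x, hx, rfl⟩ := hcov n hz
      obtain ⟨x', hx', rfl⟩ := intermediate_value_uIcc (hG.iterate n).continuousOn
        (show x ∈ uIcc (G^[n] u) (G^[n] v) by rwa [hu, hv, uIcc_of_le (hab n)])
      exact ⟨x', hx', Function.iterate_succ_apply' G n x'⟩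
    obtain ⟨x, hx, hxa⟩ := hlift _ (left_mem_Icc.2 (hab _))
    obtain ⟨y, hy, hyb⟩ := hlift _ (right_mem_Icc.2 (hab _))
    obtain ⟨u', hu', v', hv', hua, hvb, hmap⟩ :=
      exists_uIcc_mapsTo_Icc (hG.iterate (n + 1)) hxa hyb (hab _)
    refine ⟨u', v', hua, hvb, fun w hwm k hk => ?_⟩
    rcases Nat.le_succ_iff.1 hk with hk | rfl
    · exact hw w (uIcc_subset_uIcc hx hy (uIcc_subset_uIcc hu' hv' hwm)) k hk
    · exact hmap w hwm

theorem exists_periodic_iterate_mem_Icc {G : ℝ → ℝ} (hG : Continuous G) {a b : ℕ → ℝ}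
    (hab : ∀ n, a n ≤ b n)
    (hcov : ∀ n, Icc (a (n + 1)) (b (n + 1)) ⊆ G '' Icc (a n) (b n)) {L : ℕ}
    (hL : 0 < L) (ha : ∀ n, a (n + L) = a n) (hb : ∀ n, b (n + L) = b n) :
    ∃ x, G^[L] x = x ∧ ∀ n, G^[n] x ∈ Icc (a n) (b n) := by
  obtain ⟨u, v, hu, hv, hw⟩ := exists_uIcc_iterate_mem_Icc hG hab hcov L
  have ha0 := ha 0
  have hb0 := hb 0
  rw [zero_add] at ha0 hb0
  have hum := hw u left_mem_uIcc 0 (Nat.zero_le _)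
  have hvm := hw v right_mem_uIcc 0 (Nat.zero_le _)
  simp only [Function.iterate_zero, id] at hum hvm
  obtain ⟨x, hx, hx0⟩ := intermediate_value_uIcc (a := u) (b := v) (f := fun x => G^[L] x - x)
    ((hG.iterate L).sub continuous_id).continuousOn
    (show (0 : ℝ) ∈ _ from mem_uIcc.2 (Or.inl
      ⟨by rw [hu, ha0]; linarith [hum.1], by rw [hv, hb0]; linarith [hvm.2]⟩))
  have hfix : G^[L] x = x := sub_eq_zero.1 hx0
  refine ⟨x, hfix, fun n => ?_⟩
  induction n using Nat.strong_induction_on with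
  | _ n ih =>
    by_cases hn : n ≤ L
    · exact hw x hx n hn
    · obtain ⟨k, rfl⟩ := Nat.exists_eq_add_of_le' (not_le.1 hn).le
      rw [Function.iterate_add_apply, hfix, ha, hb]
      exact ih k (by omega)

theorem exists_mem_Icc_of_partition {t : ℕ → ℝ} {x : ℝ} {N : ℕ} (hN : 0 < N)
    (h0 : t 0 ≤ x) (hx : x ≤ t N) : ∃ i < N, x ∈ Icc (t i) (t (i + 1)) := by
  induction N, hN using Nat.le_induction with
  | base => exact ⟨0, one_pos, h0, hx⟩
  | succ n hn ih =>
    rcases le_total x (t n) with h | h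
    · obtain ⟨i, hi, hxi⟩ := ih h
      exact ⟨i, by omega, hxi⟩
    · exact ⟨n, by omega, h, hx⟩

/-- If a map nearly realises the transition intervals `[c i, d i]` on every subinterval of length
`σ / 2` of the cells of a partition, and those intervals stay `σ`-away from the interior partition
points, then each periodic pseudo orbit shares its itinerary with a periodic point. -/
theorem exists_periodic_same_itinerary {N : ℕ} {t c d : ℕ → ℝ} {σ θ δ : ℝ} {G : ℝ → ℝ}
    (hG : Continuous G) (hN : 0 < N) (ht0 : t 0 = 0) (htN : t N = 1)
    (ht : ∀ i < N, t i + σ ≤ t (i + 1)) (hσ : 0 < σ) (hθσ : θ ≤ σ / 4)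
    (hδσ : δ ≤ σ / 4) (hc0 : ∀ i < N, 0 ≤ c i) (hd1 : ∀ i < N, d i ≤ 1)
    (hcd : ∀ i < N, c i + σ ≤ d i)
    (hct : ∀ i < N, ∀ j < N, 0 < j → σ ≤ |c i - t j|)
    (hdt : ∀ i < N, ∀ j < N, 0 < j → σ ≤ |d i - t j|)
    (hGT : ∀ i < N, ∀ x ∈ Icc (t i) (t (i + 1)), G x ∈ Icc (c i - θ) (d i + θ))
    (hGl : ∀ i < N, ∀ u v, t i ≤ u → v ≤ t (i + 1) → u + σ / 2 ≤ v →
      ∃ x ∈ Icc u v, G x ≤ c i + θ)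
    (hGu : ∀ i < N, ∀ u v, t i ≤ u → v ≤ t (i + 1) → u + σ / 2 ≤ v →
      ∃ x ∈ Icc u v, d i - θ ≤ G x)
    {y : ℕ → ℝ} (hy : ∀ n, y n ∈ Icc (0 : ℝ) 1) (hps : ∀ n, |G (y n) - y (n + 1)| < δ)
    {L : ℕ} (hL : 1 ≤ L) (hyL : ∀ n, y (n + L) = y n) :
    ∃ x, G^[L] x = x ∧
      ∀ n, ∃ i < N, G^[n] x ∈ Icc (t i) (t (i + 1)) ∧ y n ∈ Icc (t i) (t (i + 1)) := by
  have hidx : ∀ z : ℝ, ∃ i, z ∈ Icc (0 : ℝ) 1 → i < N ∧ z ∈ Icc (t i) (t (i + 1)) := by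
    intro z
    by_cases hz : z ∈ Icc (0 : ℝ) 1
    · obtain ⟨i, hi, hzi⟩ := exists_mem_Icc_of_partition hN (ht0.symm ▸ hz.1) (htN.symm ▸ hz.2)
      exact ⟨i, fun _ => ⟨hi, hzi⟩⟩
    · exact ⟨0, fun h => absurd h hz⟩
  choose idx hidx using hidx
  have hi : ∀ n, idx (y n) < N := fun n => (hidx _ (hy n)).1
  have hyi : ∀ n, y n ∈ Icc (t (idx (y n))) (t (idx (y n) + 1)) := fun n => (hidx _ (hy n)).2
  set a : ℕ → ℝ := fun n => max (c (idx (y (n + L - 1))) + θ) (t (idx (y n))) with ha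
  set b : ℕ → ℝ := fun n => min (d (idx (y (n + L - 1))) - θ) (t (idx (y n) + 1)) with hb
  have hprev : ∀ n, y (n + 1 + L - 1) = y n := fun n => by
    rw [show n + 1 + L - 1 = n + L by omega, hyL]
  have hab : ∀ n, a n + σ / 2 ≤ b n := by
    intro n
    simp only [ha, hb]
    have hp := hps (n + L - 1)
    rw [show n + L - 1 + 1 = n + L by omega, hyL, abs_lt] at hp
    have hi' := hi (n + L - 1)
    have hg := hGT _ hi' _ (hyi (n + L - 1))
    have hyn := hyi n
    have hin := hi n
    generalize idx (y (n + L - 1)) = i at *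
    generalize idx (y n) = j at *
    have h1 : t j + σ ≤ d i := by
      rcases Nat.eq_zero_or_pos j with rfl | hj
      · have := hc0 i hi'
        have := hcd i hi'
        rw [ht0]; linarith
      · rcases le_abs.1 (hdt i hi' j hin hj) with h | h
        · linarith
        · linarith [hg.2, hyn.1]
    have h2 : c i + σ ≤ t (j + 1) := by
      rcases Nat.lt_or_ge (j + 1) N with hj | hj
      · rcases le_abs.1 (hct i hi' (j + 1) hj (Nat.succ_pos _)) with h | h
        · linarith [hg.1, hyn.2]
        · linarith
      · rw [show j + 1 = N by omega, htN]
        linarith [hcd i hi', hd1 i hi']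
    have h3 := hcd i hi'
    have h4 := ht j hin
    refine le_min ?_ ?_ <;> rw [← le_sub_iff_add_le] <;> refine max_le ?_ ?_ <;> linarith
  obtain ⟨x, hx, hxn⟩ := exists_periodic_iterate_mem_Icc (a := a) (b := b) hG
    (fun n => by linarith [hab n]) (fun n z hz => by
      obtain ⟨p, hp, hpc⟩ := hGl _ (hi n) (a n) (b n) (le_max_right _ _) (min_le_right _ _) (hab n)
      obtain ⟨q, hq, hqd⟩ := hGu _ (hi n) (a n) (b n) (le_max_right _ _) (min_le_right _ _) (hab n)
      have hza : c (idx (y n)) + θ ≤ z := by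
        have := (le_max_left _ _).trans hz.1
        rwa [hprev] at this
      have hzb : z ≤ d (idx (y n)) - θ := by
        have := hz.2.trans (min_le_left _ _)
        rwa [hprev] at this
      obtain ⟨w, hw, hwz⟩ := intermediate_value_uIcc (a := p) (b := q) hG.continuousOn
        (show z ∈ _ from mem_uIcc.2 (Or.inl ⟨hpc.trans hza, hzb.trans hqd⟩))
      exact ⟨w, uIcc_subset_Icc hp hq hw, hwz⟩) hL
    (fun n => by
      simp only [ha]
      rw [hyL, show n + L + L - 1 = (n + L - 1) + L by omega, hyL])
    (fun n => by
      simp only [hb]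
      rw [hyL, show n + L + L - 1 = (n + L - 1) + L by omega, hyL])
  exact ⟨x, hx, fun n => ⟨_, hi n, ⟨(le_max_right _ _).trans (hxn n).1,
    (hxn n).2.trans (min_le_right _ _)⟩, hyi n⟩⟩

/-- The triangle wave of period `2` with values in `[0,1]`. -/
def triangleWave (u : ℝ) : ℝ := Real.arccos (Real.cos (Real.pi * u)) / Real.pi

theorem continuous_triangleWave : Continuous triangleWave := by
  unfold triangleWave
  fun_prop

theorem triangleWave_mem (u : ℝ) : triangleWave u ∈ Icc (0 : ℝ) 1 :=
  ⟨div_nonneg (Real.arccos_nonneg _) Real.pi_pos.le,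
    (div_le_one Real.pi_pos).2 (Real.arccos_le_pi _)⟩

theorem triangleWave_of_mem {u : ℝ} (hu : u ∈ Icc (0 : ℝ) 1) : triangleWave u = u := by
  have hpi := Real.pi_pos
  rw [triangleWave, Real.arccos_cos (by have := hu.1; positivity)
    (by nlinarith [hu.2]), mul_div_cancel_left₀ _ hpi.ne']

theorem triangleWave_neg (u : ℝ) : triangleWave (-u) = triangleWave u := by
  simp [triangleWave]

theorem triangleWave_add_two_mul (u : ℝ) (k : ℕ) :
    triangleWave (u + 2 * k) = triangleWave u := by
  rw [triangleWave, show Real.pi * (u + 2 * k) = Real.pi * u + k * (2 * Real.pi) by ring,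
    Real.cos_add_nat_mul_two_pi, triangleWave]

theorem triangleWave_even_cell {u : ℝ} {k : ℕ} (hu : u ∈ Icc (2 * k : ℝ) (2 * k + 1)) :
    triangleWave u = u - 2 * k := by
  rw [← triangleWave_of_mem (u := u - 2 * k) ⟨by linarith [hu.1], by linarith [hu.2]⟩,
    ← triangleWave_add_two_mul (u - 2 * k) k, sub_add_cancel]

theorem triangleWave_odd_cell {u : ℝ} {k : ℕ} (hu : u ∈ Icc (2 * k + 1 : ℝ) (2 * k + 2)) :
    triangleWave u = 2 * k + 2 - u := by
  rw [← triangleWave_of_mem (u := 2 * k + 2 - u) ⟨by linarith [hu.2], by linarith [hu.1]⟩,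
    ← triangleWave_neg, ← triangleWave_add_two_mul _ (k + 1)]
  congr 1
  push_cast
  ring

theorem integral_comp_triangleWave_cell (H : ℝ → ℝ) (k : ℕ) :
    ∫ u in (k : ℝ)..(k + 1 : ℕ), H (triangleWave u) = ∫ u in (0 : ℝ)..1, H u := by
  rcases Nat.even_or_odd' k with ⟨j, rfl | rfl⟩
  · rw [intervalIntegral.integral_congr (g := fun u => H (u - 2 * j)),
      intervalIntegral.integral_comp_sub_right H]
    · congr 1 <;> push_cast <;> ring
    · intro u hu
      rw [uIcc_of_le (by push_cast; linarith)] at hu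
      push_cast at hu
      simp only [triangleWave_even_cell hu]
  · rw [intervalIntegral.integral_congr (g := fun u => H (2 * j + 2 - u)),
      intervalIntegral.integral_comp_sub_left H]
    · congr 1 <;> push_cast <;> ring
    · intro u hu
      rw [uIcc_of_le (by push_cast; linarith)] at hu
      push_cast at hu
      simp only [triangleWave_odd_cell (k := j) ⟨hu.1, by linarith [hu.2]⟩]

theorem integral_comp_triangleWave {H : ℝ → ℝ} (hH : Measurable H) {C : ℝ}
    (hC : ∀ u, ‖H u‖ ≤ C) (m : ℕ) :
    ∫ u in (0 : ℝ)..m, H (triangleWave u) = m * ∫ u in (0 : ℝ)..1, H u := by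
  have hint : ∀ a b, IntervalIntegrable (fun u => H (triangleWave u)) volume a b := fun a b =>
    (intervalIntegrable_const (c := C)).mono_fun
      (hH.comp continuous_triangleWave.measurable).aestronglyMeasurable
      (.of_forall fun u => (hC _).trans (le_abs_self C))
  have := intervalIntegral.sum_integral_adjacent_intervals (a := fun k : ℕ => (k : ℝ))
    (n := m) (μ := volume) (fun k _ => hint k (k + 1 : ℕ))
  simp only [Nat.cast_zero] at this
  rw [← this]
  simp_rw [integral_comp_triangleWave_cell]
  simp

/-- The affine copy on `[a,b]` of the triangle wave with `m` laps. -/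
def zigzag (a b : ℝ) (m : ℕ) (x : ℝ) : ℝ :=
  a + (b - a) * triangleWave (m * ((x - a) / (b - a)))

theorem continuous_zigzag (a b : ℝ) (m : ℕ) : Continuous (zigzag a b m) := by
  have := continuous_triangleWave
  unfold zigzag
  fun_prop

theorem zigzag_mem {a b : ℝ} (hab : a < b) (m : ℕ) (x : ℝ) : zigzag a b m x ∈ Icc a b := by
  obtain ⟨h0, h1⟩ := triangleWave_mem (m * ((x - a) / (b - a)))
  have hba : 0 < b - a := sub_pos.2 hab
  exact ⟨by unfold zigzag; nlinarith, by unfold zigzag; nlinarith⟩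

theorem zigzag_left (a b : ℝ) (m : ℕ) : zigzag a b m a = a := by
  simp [zigzag, triangleWave_of_mem (show (0 : ℝ) ∈ Icc (0 : ℝ) 1 by simp)]

theorem zigzag_right {a b : ℝ} (hab : a < b) (r : ℕ) : zigzag a b (2 * r + 1) b = b := by
  have h : triangleWave ((2 * r + 1 : ℕ) : ℝ) = 1 := by
    rw [triangleWave_even_cell (k := r) (by simp)]
    push_cast
    ring
  rw [zigzag, div_self (sub_pos.2 hab).ne', mul_one, h]
  ring

theorem integral_comp_zigzag {H : ℝ → ℝ} (hH : Measurable H) {C : ℝ} (hC : ∀ u, ‖H u‖ ≤ C)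
    {a b : ℝ} (hab : a < b) {m : ℕ} (hm : 0 < m) :
    ∫ x in a..b, H (zigzag a b m x) = ∫ x in a..b, H x := by
  have hba : b - a ≠ 0 := (sub_pos.2 hab).ne'
  have hm' : (m : ℝ) ≠ 0 := by positivity
  have h1 := intervalIntegral.integral_comp_mul_add (a := a) (b := b)
    (fun u => H (a + (b - a) * triangleWave u)) (c := m / (b - a)) (div_ne_zero hm' hba)
    (-(m / (b - a) * a))
  have h2 := intervalIntegral.integral_comp_add_mul (a := 0) (b := 1) H hba a
  have h3 := integral_comp_triangleWave (H := fun u => H (a + (b - a) * u))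
    (hH.comp (by fun_prop)) (fun u => hC _) m
  rw [h2] at h3
  have e1 : m / (b - a) * a + -(m / (b - a) * a) = 0 := by ring
  have e2 : m / (b - a) * b + -(m / (b - a) * a) = m := by field_simp; ring
  rw [e1, e2, h3] at h1
  simp only [zigzag]
  have e3 : ∀ x, m / (b - a) * x + -(m / (b - a) * a) = m * ((x - a) / (b - a)) := fun x => by
    field_simp
    ring
  simp only [e3] at h1
  rw [h1]
  simp only [smul_eq_mul, mul_zero, add_zero, mul_one, add_sub_cancel]
  field_simp

theorem Icc_subset_zigzag_image {a b : ℝ} (hab : a < b) {m : ℕ} (hm : 0 < m) {u v : ℝ}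
    (hau : a ≤ u) (huv : u + 2 * (b - a) / m ≤ v) : Icc a b ⊆ zigzag a b m '' Icc u v := by
  have hba : 0 < b - a := sub_pos.2 hab
  have hm' : (0 : ℝ) < m := by positivity
  set k := ⌈m * ((u - a) / (b - a))⌉₊ with hk
  have hk0 : m * ((u - a) / (b - a)) ≤ k := Nat.le_ceil _
  have hk1 : k < m * ((u - a) / (b - a)) + 1 :=
    Nat.ceil_lt_add_one (mul_nonneg hm'.le (div_nonneg (by linarith) hba.le))
  set P : ℝ → ℝ := fun w => a + (b - a) * w / m with hP
  have hval : ∀ w, zigzag a b m (P w) = a + (b - a) * triangleWave w := fun w => by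
    simp only [zigzag, hP]
    congr 3
    field_simp
    ring
  have hPl : ∀ w, (k : ℝ) ≤ w → w ≤ k + 1 → P w ∈ Icc u v := by
    intro w h1 h2
    have e : m * ((u - a) / (b - a)) * ((b - a) / m) = u - a := by field_simp
    have hpos : 0 < (b - a) / m := div_pos hba hm'
    have e2 : 2 * (b - a) / m = 2 * ((b - a) / m) := by ring
    have e3 : P w = a + w * ((b - a) / m) := by simp only [hP]; ring
    rw [e2] at huv
    rw [e3]
    constructor <;> nlinarith
  have key : ∀ p q : ℝ, P p ∈ Icc u v → P q ∈ Icc u v → triangleWave p = 0 →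
      triangleWave q = 1 → Icc a b ⊆ zigzag a b m '' Icc u v := by
    intro p q hp hq hp0 hq1 w hw
    obtain ⟨x, hx, hxw⟩ := intermediate_value_uIcc (a := P p) (b := P q)
      (continuous_zigzag a b m).continuousOn (show w ∈ _ by
        rw [hval, hval, hp0, hq1]
        exact mem_uIcc.2 (Or.inl ⟨by linarith [hw.1], by linarith [hw.2]⟩))
    exact ⟨x, uIcc_subset_Icc hp hq hx, hxw⟩
  have hkm := hPl k le_rfl (by linarith)
  have hkm1 := hPl (k + 1) (by linarith) le_rfl
  rcases Nat.even_or_odd' k with ⟨j, hj | hj⟩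
  · refine key k (k + 1) hkm hkm1 ?_ ?_ <;> rw [hj] <;> push_cast <;>
      rw [triangleWave_even_cell (k := j) (by simp)] <;> ring
  · refine key (k + 1) k hkm1 hkm ?_ ?_ <;> rw [hj] <;> push_cast <;>
      rw [triangleWave_odd_cell (k := j) ⟨by linarith, by linarith⟩] <;> ring

/-- Folding each cell of a partition of `[0,1]` onto itself by a map preserving Lebesgue measure. -/
theorem exists_fold {N : ℕ} {t : ℕ → ℝ} (ht0 : t 0 = 0) (htN : t N = 1)
    (ht : ∀ i < N, t i < t (i + 1)) {γ : ℝ} (hγ : 0 < γ) :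
    ∃ Z : ℝ → ℝ, Continuous Z ∧
      (∀ i < N, MapsTo Z (Icc (t i) (t (i + 1))) (Icc (t i) (t (i + 1)))) ∧
      (∀ i < N, ∀ u v, t i ≤ u → v ≤ t (i + 1) → u + γ ≤ v →
        Icc (t i) (t (i + 1)) ⊆ Z '' Icc u v) ∧
      ∀ B, MeasurableSet B → volume (Icc 0 1 ∩ Z ⁻¹' B) = volume (Icc 0 1 ∩ B) := by
  have hmono : ∀ i j, i ≤ j → j ≤ N → t i ≤ t j := by
    intro i j hij
    induction j, hij using Nat.le_induction with
    | base => exact fun _ => le_rfl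
    | succ j _ ih => exact fun hj => (ih (by omega)).trans (ht j (by omega)).le
  obtain ⟨r, hr⟩ := exists_nat_gt (2 / γ)
  set m := 2 * r + 1 with hm
  set D : ℕ → ℝ → ℝ := fun i x =>
    zigzag (t i) (t (i + 1)) m (max (t i) (min (t (i + 1)) x)) -
      max (t i) (min (t (i + 1)) x) with hD
  set Z : ℝ → ℝ := fun x => x + ∑ i ∈ Finset.range N, D i x with hZ
  have hDl : ∀ i < N, ∀ x ≤ t i, D i x = 0 := fun i hi x hx => by
    simp only [hD]
    rw [min_eq_right (hx.trans (ht i hi).le), max_eq_left hx, zigzag_left, sub_self]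
  have hDr : ∀ i < N, ∀ x, t (i + 1) ≤ x → D i x = 0 := fun i hi x hx => by
    simp only [hD]
    rw [min_eq_left hx, max_eq_right (ht i hi).le, hm, zigzag_right (ht i hi), sub_self]
  have hZi : ∀ i < N, ∀ x ∈ Icc (t i) (t (i + 1)), Z x = zigzag (t i) (t (i + 1)) m x := by
    intro i hi x hx
    simp only [hZ]
    rw [Finset.sum_eq_single i]
    · simp only [hD]
      rw [min_eq_right hx.2, max_eq_right hx.1]
      ring
    · intro j hj hji
      have hj := Finset.mem_range.1 hj
      rcases lt_or_gt_of_ne hji with h | h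
      · exact hDr j hj x ((hmono (j + 1) i h hi.le).trans hx.1)
      · exact hDl j hj x (hx.2.trans (hmono (i + 1) j h hj.le))
    · exact fun h => absurd (Finset.mem_range.2 hi) h
  have hZc : Continuous Z := by
    have := fun i => continuous_zigzag (t i) (t (i + 1)) m
    simp only [hZ, hD]
    fun_prop
  refine ⟨Z, hZc, fun i hi x hx => ?_, fun i hi u v hu hv huv w hw => ?_, fun B hB => ?_⟩
  · rw [hZi i hi x hx]
    exact zigzag_mem (ht i hi) _ _
  · have hlen : t (i + 1) - t i ≤ 1 := by
      have h1 := hmono (i + 1) N hi le_rfl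
      have h2 := hmono 0 i (Nat.zero_le _) hi.le
      linarith
    have h2m : 2 * (t (i + 1) - t i) / m ≤ γ := by
      have hm0 : (0 : ℝ) < m := by positivity
      rw [div_lt_iff₀ hγ] at hr
      rw [div_le_iff₀ hm0, hm]
      push_cast
      nlinarith [hr]
    obtain ⟨x, hx, hxw⟩ := Icc_subset_zigzag_image (ht i hi) (m := m) (Nat.succ_pos _) hu
      (v := v) (by linarith) hw
    exact ⟨x, hx, by rw [hZi i hi x ⟨hu.trans hx.1, hx.2.trans hv⟩, hxw]⟩
  · set H : ℝ → ℝ := B.indicator 1 with hHdef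
    have hH : Measurable H := measurable_one.indicator hB
    have hC : ∀ u, ‖H u‖ ≤ 1 := fun u => by
      simpa using norm_indicator_le_norm_self (s := B) (f := (1 : ℝ → ℝ)) u
    have hii : ∀ (φ : ℝ → ℝ) (a b : ℝ), Measurable φ →
        IntervalIntegrable (fun u => H (φ u)) volume a b := fun φ a b hφ =>
      (intervalIntegrable_const (c := (1 : ℝ))).mono_fun
        (hH.comp hφ).aestronglyMeasurable (.of_forall fun u => by simpa using hC (φ u))
    have hint : ∫ x in (0 : ℝ)..1, H (Z x) = ∫ x in (0 : ℝ)..1, H x := by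
      have h1 := intervalIntegral.sum_integral_adjacent_intervals (a := t) (n := N)
        (μ := volume) (fun k _ => hii Z (t k) (t (k + 1)) hZc.measurable)
      have h2 := intervalIntegral.sum_integral_adjacent_intervals (a := t) (n := N)
        (μ := volume) (fun k _ => hii id (t k) (t (k + 1)) measurable_id)
      rw [ht0, htN] at h1 h2
      rw [← h1]
      refine Eq.trans (Finset.sum_congr rfl fun i hi => ?_) h2
      have hi := Finset.mem_range.1 hi
      rw [intervalIntegral.integral_congr (g := fun x => H (zigzag (t i) (t (i + 1)) m x)),
        integral_comp_zigzag hH hC (ht i hi) (Nat.succ_pos _)]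
      · rfl
      · intro x hx
        rw [uIcc_of_le (ht i hi).le] at hx
        simp only [hZi i hi x hx]
    have hreal : ∀ φ : ℝ → ℝ, Measurable φ →
        ∫ x in (0 : ℝ)..1, H (φ x) = volume.real (Icc 0 1 ∩ φ ⁻¹' B) := fun φ hφ => by
      rw [intervalIntegral.integral_of_le zero_le_one, ← integral_Icc_eq_integral_Ioc,
        show (fun x => H (φ x)) = (φ ⁻¹' B).indicator 1 from rfl,
        integral_indicator_one (hφ hB), measureReal_restrict_apply (hφ hB), inter_comm]
    have hfin : ∀ S : Set ℝ, volume (Icc (0 : ℝ) 1 ∩ S) ≠ ⊤ := fun S =>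
      (measure_mono inter_subset_left).trans_lt (by simp) |>.ne
    rw [hreal Z hZc.measurable] at hint
    have h3 := hreal id measurable_id
    simp only [id] at h3
    rw [h3] at hint
    exact (ENNReal.toReal_eq_toReal_iff' (hfin _) (hfin _)).1 hint

/-- The extension of a self-map of `[0,1]` to the line, constant on both sides of `[0,1]`. -/
def realExt (f : C(unitInterval, unitInterval)) (x : ℝ) : ℝ :=
  f (projIcc 0 1 zero_le_one x)

theorem continuous_realExt (f : C(unitInterval, unitInterval)) : Continuous (realExt f) := by
  have := continuous_projIcc (h := zero_le_one (α := ℝ))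
  unfold realExt
  fun_prop

theorem realExt_mem (f : C(unitInterval, unitInterval)) (x : ℝ) :
    realExt f x ∈ Icc (0 : ℝ) 1 := (f _).2

@[simp]
theorem realExt_coe (f : C(unitInterval, unitInterval)) (x : unitInterval) :
    realExt f x = f x := by
  rw [realExt, projIcc_val]

theorem iterate_realExt_coe (f : C(unitInterval, unitInterval)) (n : ℕ) (x : unitInterval) :
    (realExt f)^[n] x = (f^[n] x : unitInterval) :=
  ((show Function.Semiconj Subtype.val f (realExt f) from
    fun x => (realExt_coe f x).symm).iterate_right n x).symm

theorem lebI_apply (A : Set unitInterval) : lebI A = volume (Subtype.val '' A) :=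
  comap_subtype_coe_apply measurableSet_Icc volume A

theorem comp_mem_CLam {f g : C(unitInterval, unitInterval)} (hf : f ∈ CLam) (hg : g ∈ CLam) :
    f.comp g ∈ CLam := fun A hA => by
  rw [ContinuousMap.coe_comp, preimage_comp, hg _ (f.continuous.measurable hA), hf A hA]

theorem exists_mem_CLam_of_real {Z : ℝ → ℝ} (hZ : Continuous Z)
    (hmaps : MapsTo Z (Icc 0 1) (Icc 0 1))
    (hvol : ∀ B, MeasurableSet B → volume (Icc 0 1 ∩ Z ⁻¹' B) = volume (Icc 0 1 ∩ B)) :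
    ∃ z ∈ CLam, ∀ x : unitInterval, (z x : ℝ) = Z x := by
  refine ⟨⟨fun x => ⟨Z x, hmaps x.2⟩, by fun_prop⟩, fun A hA => ?_, fun x => rfl⟩
  have hB : MeasurableSet (Subtype.val '' A : Set ℝ) :=
    (MeasurableEmbedding.subtype_coe measurableSet_Icc).measurableSet_image' hA
  have h := hvol _ hB
  rw [lebI_apply, lebI_apply]
  convert h using 2
  · ext x
    constructor
    · rintro ⟨x, hx, rfl⟩
      exact ⟨x.2, _, hx, rfl⟩
    · rintro ⟨hx, y, hy, hyx⟩
      refine ⟨⟨x, hx⟩, ?_, rfl⟩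
      have : y = ⟨Z x, hmaps hx⟩ := Subtype.ext hyx
      rwa [this] at hy
  · refine (inter_eq_right.2 ?_).symm
    rintro _ ⟨x, _, rfl⟩
    exact x.2

theorem exists_realExt_ne_of_mem_CLam {f : C(unitInterval, unitInterval)} (hf : f ∈ CLam)
    {a b : ℝ} (ha : 0 ≤ a) (hab : a < b) (hb : b ≤ 1) (c : ℝ) :
    ∃ x ∈ Icc a b, realExt f x ≠ c := by
  by_contra! hcon
  have haI : a ∈ unitInterval := ⟨ha, hab.le.trans hb⟩
  have h := hf {f ⟨a, haI⟩} (measurableSet_singleton _)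
  rw [lebI_apply, lebI_apply, image_singleton, Real.volume_singleton] at h
  have hsub : Icc a b ⊆ Subtype.val '' (f ⁻¹' {f ⟨a, haI⟩}) := fun x hx => by
    refine ⟨⟨x, ha.trans hx.1, hx.2.trans hb⟩, Subtype.ext ?_, rfl⟩
    rw [← realExt_coe, ← realExt_coe, hcon x hx, hcon a (left_mem_Icc.2 hab.le)]
  have hle := measure_mono (μ := volume) hsub
  rw [h, Real.volume_Icc, nonpos_iff_eq_zero, ENNReal.ofReal_eq_zero] at hle
  linarith

/-- The instance at scale `ε` of the periodic shadowing property. -/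
def PeriodicShadowingAt (f : unitInterval → unitInterval) (ε : ℝ) : Prop :=
  ∃ δ > (0 : ℝ), ∀ y : ℕ → unitInterval, IsPseudoOrbit f δ y → PeriodicSeq y →
    ∃ x : unitInterval, IsPeriodicPt' f x ∧ Traces f ε x y

theorem exists_pos_le_sub {ι : Type*} (s : Finset ι) {a b : ι → ℝ} (h : ∀ i ∈ s, a i < b i) :
    ∀ᶠ σ in 𝓝[>] (0 : ℝ), ∀ i ∈ s, a i + σ ≤ b i := by
  rw [Finset.eventually_all]
  intro i hi
  filter_upwards [nhdsWithin_le_nhds (Iic_mem_nhds (sub_pos.2 (h i hi)))] with σ hσ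
  linarith [mem_Iic.1 hσ]

theorem periodicShadowingAt_near_of_partition {f : C(unitInterval, unitInterval)} {N : ℕ}
    {t c d : ℕ → ℝ} {ε : ℝ} (hN : 0 < N) (ht0 : t 0 = 0) (htN : t N = 1)
    (ht : ∀ i < N, t i < t (i + 1)) (hmesh : ∀ i < N, t (i + 1) - t i < ε)
    (hcd : ∀ i < N, c i < d i)
    (hmaps : ∀ i < N, MapsTo (realExt f) (Icc (t i) (t (i + 1))) (Icc (c i) (d i)))
    (hl : ∀ i < N, c i ∈ realExt f '' Icc (t i) (t (i + 1)))
    (hu : ∀ i < N, d i ∈ realExt f '' Icc (t i) (t (i + 1)))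
    (hct : ∀ i < N, ∀ j < N, 0 < j → c i ≠ t j) (hdt : ∀ i < N, ∀ j < N, 0 < j → d i ≠ t j) :
    ∃ z ∈ CLam, (∀ x, dist (z x) x < ε) ∧ ∃ θ > 0, ∀ g : C(unitInterval, unitInterval),
      dist g (f.comp z) < θ → PeriodicShadowingAt g ε := by
  have hpos : ∀ᶠ σ in 𝓝[>] (0 : ℝ), 0 < σ := self_mem_nhdsWithin
  have hct' := exists_pos_le_sub (Finset.range N ×ˢ (Finset.range N).filter (0 < ·))
    (a := 0) (b := fun p => |c p.1 - t p.2|) (fun p hp => by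
      simp only [Finset.mem_product, Finset.mem_range, Finset.mem_filter] at hp
      exact abs_pos.2 (sub_ne_zero.2 (hct _ hp.1 _ hp.2.1 hp.2.2)))
  have hdt' := exists_pos_le_sub (Finset.range N ×ˢ (Finset.range N).filter (0 < ·))
    (a := 0) (b := fun p => |d p.1 - t p.2|) (fun p hp => by
      simp only [Finset.mem_product, Finset.mem_range, Finset.mem_filter] at hp
      exact abs_pos.2 (sub_ne_zero.2 (hdt _ hp.1 _ hp.2.1 hp.2.2)))
  have hcd' := exists_pos_le_sub (Finset.range N) (a := c) (b := d)
    (fun i hi => hcd i (Finset.mem_range.1 hi))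
  have ht' := exists_pos_le_sub (Finset.range N) (a := t) (b := fun i => t (i + 1))
    (fun i hi => ht i (Finset.mem_range.1 hi))
  obtain ⟨σ, hσ, hct', hdt', hcd', ht'⟩ :=
    (hpos.and (hct'.and (hdt'.and (hcd'.and ht')))).exists
  simp only [Finset.mem_product, Finset.mem_range, Finset.mem_filter, Pi.zero_apply,
    zero_add, and_imp, Prod.forall] at hct' hdt' hcd' ht'
  obtain ⟨Z, hZc, hZmaps, hZcov, hZvol⟩ := exists_fold ht0 htN ht (half_pos hσ)
  have hcell : ∀ x ∈ Icc (0 : ℝ) 1, ∃ i < N, x ∈ Icc (t i) (t (i + 1)) := fun x hx =>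
    exists_mem_Icc_of_partition hN (ht0.symm ▸ hx.1) (htN.symm ▸ hx.2)
  have hmono : ∀ i j, i ≤ j → j ≤ N → t i ≤ t j := by
    intro i j hij
    induction j, hij using Nat.le_induction with
    | base => exact fun _ => le_rfl
    | succ j _ ih => exact fun hj => (ih (by omega)).trans (ht j (by omega)).le
  have hT : ∀ i < N, Icc (t i) (t (i + 1)) ⊆ Icc 0 1 := fun i hi =>
    Icc_subset_Icc (ht0 ▸ hmono 0 i (Nat.zero_le _) hi.le) (htN ▸ hmono (i + 1) N hi le_rfl)
  obtain ⟨z, hz, hzZ⟩ := exists_mem_CLam_of_real hZc (fun x hx => by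
    obtain ⟨i, hi, hxi⟩ := hcell x hx
    exact hT i hi (hZmaps i hi hxi)) hZvol
  refine ⟨z, hz, fun x => ?_, σ / 4, by positivity, fun g hg => ⟨σ / 4, by positivity, ?_⟩⟩
  · obtain ⟨i, hi, hxi⟩ := hcell x x.2
    have hZx := hZmaps i hi hxi
    rw [Subtype.dist_eq, hzZ]
    exact (Real.dist_le_of_mem_Icc hZx hxi).trans_lt (hmesh i hi)
  have hGclose : ∀ x ∈ Icc (0 : ℝ) 1, |realExt g x - realExt f (Z x)| ≤ σ / 4 := by
    intro x hx
    lift x to unitInterval using hx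
    have := (ContinuousMap.dist_lt_iff (by positivity)).1 hg x
    rw [← hzZ, realExt_coe, realExt_coe]
    exact this.le
  rintro y hy ⟨L, hL, hyL⟩
  have hlift : ∀ i < N, ∀ u v w, w ∈ realExt f '' Icc (t i) (t (i + 1)) → t i ≤ u →
      v ≤ t (i + 1) → u + σ / 2 ≤ v → ∃ x ∈ Icc u v, |realExt g x - w| ≤ σ / 4 := by
    rintro i hi u v _ ⟨x, hx, rfl⟩ hu hv huv
    obtain ⟨x', hx', rfl⟩ := hZcov i hi u v hu hv huv hx
    exact ⟨x', hx', hGclose x' (hT i hi ⟨hu.trans hx'.1, hx'.2.trans hv⟩)⟩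
  obtain ⟨x, hxL, hx⟩ := exists_periodic_same_itinerary (t := t) (c := c) (d := d)
    (σ := σ) (θ := σ / 4) (δ := σ / 4) (y := fun n => y n) (L := L)
    (continuous_realExt g) hN ht0 htN ht' hσ le_rfl le_rfl
    (fun i hi => by
      obtain ⟨x, -, hx⟩ := hl i hi
      exact hx ▸ (realExt_mem f x).1)
    (fun i hi => by
      obtain ⟨x, -, hx⟩ := hu i hi
      exact hx ▸ (realExt_mem f x).2)
    hcd' (fun i hi j hj => hct' i j hi hj) (fun i hi j hj => hdt' i j hi hj)
    (fun i hi x hx => by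
      have h1 := abs_le.1 (hGclose x (hT i hi hx))
      have h2 := hmaps i hi (hZmaps i hi hx)
      exact ⟨by linarith [h2.1], by linarith [h2.2]⟩)
    (fun i hi u v hu hv huv => by
      obtain ⟨x, hx, hxw⟩ := hlift i hi u v _ (hl i hi) hu hv huv
      exact ⟨x, hx, by linarith [(abs_le.1 hxw).2]⟩)
    (fun i hi u v hu' hv huv => by
      obtain ⟨x, hx, hxw⟩ := hlift i hi u v _ (hu i hi) hu' hv huv
      exact ⟨x, hx, by linarith [(abs_le.1 hxw).1]⟩)
    (fun n => (y n).2) (fun n => by rw [realExt_coe]; exact hy n) hL (fun n => by simp only [hyL])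
  obtain ⟨i, hi, hx0, -⟩ := hx 0
  have hxI : x ∈ unitInterval := hT i hi hx0
  lift x to unitInterval using hxI
  refine ⟨x, ⟨L, hL, Subtype.ext ?_⟩, fun n => ?_⟩
  · rw [← iterate_realExt_coe, hxL]
  · obtain ⟨i, hi, hxn, hyn⟩ := hx n
    rw [iterate_realExt_coe] at hxn
    exact (Real.dist_le_of_mem_Icc hxn hyn).trans_lt (hmesh i hi)

/-- After folding the cells of the uniform partition of `[0,1]` into `K` pieces, the partition can
be shifted so that the extreme values of the folded map on its cells avoid the partition points. -/
theorem exists_fold_generic_partition {f : C(unitInterval, unitInterval)} (hf : f ∈ CLam) {K : ℕ}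
    (hK : 0 < K) :
    ∃ z ∈ CLam, (∀ x, dist (z x) x ≤ 1 / K) ∧ ∃ t c d : ℕ → ℝ, t 0 = 0 ∧ t (K + 1) = 1 ∧
      (∀ i < K + 1, t i < t (i + 1)) ∧ (∀ i < K + 1, t (i + 1) - t i ≤ 1 / K) ∧
      (∀ i < K + 1, c i < d i) ∧
      (∀ i < K + 1, MapsTo (realExt (f.comp z)) (Icc (t i) (t (i + 1))) (Icc (c i) (d i))) ∧
      (∀ i < K + 1, c i ∈ realExt (f.comp z) '' Icc (t i) (t (i + 1))) ∧
      (∀ i < K + 1, d i ∈ realExt (f.comp z) '' Icc (t i) (t (i + 1))) ∧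
      (∀ i < K + 1, ∀ j < K + 1, 0 < j → c i ≠ t j) ∧
      (∀ i < K + 1, ∀ j < K + 1, 0 < j → d i ≠ t j) := by
  have hK' : (0 : ℝ) < K := by positivity
  set A : ℕ → ℝ := fun i => i / K with hA
  have hA0 : A 0 = 0 := by simp [hA]
  have hAK : A K = 1 := by simp [hA, hK'.ne']
  have hAs : ∀ i, A (i + 1) = A i + 1 / K := fun i => by simp only [hA]; push_cast; ring
  have hK1 : 0 < 1 / (K : ℝ) := by positivity
  have hAmono : Monotone A := monotone_nat_of_le_succ fun i => by rw [hAs]; linarith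
  obtain ⟨Z, hZc, hZmaps, hZcov, hZvol⟩ := exists_fold (N := K) (t := A) hA0 hAK
    (fun i _ => by rw [hAs]; linarith) (γ := 1 / K / 3) (by positivity)
  have hcell : ∀ x ∈ Icc (0 : ℝ) 1, ∃ i < K, x ∈ Icc (A i) (A (i + 1)) := fun x hx =>
    exists_mem_Icc_of_partition hK (hA0.symm ▸ hx.1) (hAK.symm ▸ hx.2)
  have hA01 : ∀ i ≤ K, A i ∈ Icc (0 : ℝ) 1 := fun i hi =>
    ⟨hA0 ▸ hAmono (Nat.zero_le i), hAK ▸ hAmono hi⟩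
  obtain ⟨z, hz, hzZ⟩ := exists_mem_CLam_of_real hZc (fun x hx => by
    obtain ⟨i, hi, hxi⟩ := hcell x hx
    exact Icc_subset_Icc (hA01 i hi.le).1 (hA01 (i + 1) hi).2 (hZmaps i hi hxi)) hZvol
  set l : ℕ → ℝ := fun j => A (j - 1) with hl
  set r : ℕ → ℝ := fun j => A (min (j + 1) K) with hr
  have hlr : ∀ j < K + 1, l j < r j := fun j hj => by
    have h1 : j - 1 + 1 ≤ min (j + 1) K := by omega
    have h2 := hAmono h1
    rw [hAs] at h2
    simp only [hl, hr]
    linarith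
  have hS : ∀ j < K + 1, Icc (l j) (r j) ⊆ Icc 0 1 := fun j hj =>
    Icc_subset_Icc (hA01 _ (by omega)).1 (hA01 _ (min_le_right _ _)).2
  have hext : ∀ j, ∃ x y, j < K + 1 → x ∈ Icc (l j) (r j) ∧ y ∈ Icc (l j) (r j) ∧
      ∀ w ∈ Icc (l j) (r j), realExt f w ∈ Icc (realExt f x) (realExt f y) := by
    intro j
    by_cases hj : j < K + 1
    · have hne := nonempty_Icc.2 (hlr j hj).le
      obtain ⟨x, hx, hmin⟩ := isCompact_Icc.exists_isMinOn hne (continuous_realExt f).continuousOn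
      obtain ⟨y, hy, hmax⟩ := isCompact_Icc.exists_isMaxOn hne (continuous_realExt f).continuousOn
      exact ⟨x, y, fun _ => ⟨hx, hy, fun w hw => ⟨hmin hw, hmax hw⟩⟩⟩
    · exact ⟨0, 0, fun h => absurd h hj⟩
  choose p q hpq using hext
  have hbad : (⋃ i ∈ Finset.range (K + 1), ⋃ j ∈ Finset.range K,
      ({K * realExt f (p i) - j, K * realExt f (q i) - j} : Set ℝ)).Finite :=
    (Finset.range (K + 1)).finite_toSet.biUnion fun i _ =>
      (Finset.range K).finite_toSet.biUnion fun j _ => (Set.finite_singleton _).insert _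
  obtain ⟨s, ⟨hs1, hs2⟩, hs⟩ :=
    (Ioo_infinite (show (1 / 3 : ℝ) < 2 / 3 by norm_num)).exists_notMem_finite hbad
  simp only [Finset.mem_range, mem_iUnion, mem_insert_iff, mem_singleton_iff, exists_prop,
    not_exists, not_and, not_or] at hs
  set M : ℕ → ℝ := fun i => A i + s * (1 / K) with hM
  have hM1 : ∀ i, A i + 1 / K / 3 ≤ M i := fun i => by simp only [hM]; nlinarith
  have hM2 : ∀ i, M i + 1 / K / 3 ≤ A (i + 1) := fun i => by
    rw [hAs]; simp only [hM]; nlinarith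
  have hMs : ∀ i, M (i + 1) = M i + 1 / K := fun i => by simp only [hM, hAs]; ring
  have hMeq : ∀ i x, x = M i → K * x - i = s := fun i x hx => by
    rw [hx]
    simp only [hM, hA]
    field_simp
    ring
  have hL1 : ∀ i < K, Icc (A i) (A (i + 1)) ⊆ Z '' Icc (A i) (M i) := fun i hi =>
    hZcov i hi _ _ le_rfl (by linarith [hM2 i]) (hM1 i)
  have hR1 : ∀ i < K, Icc (A i) (A (i + 1)) ⊆ Z '' Icc (M i) (A (i + 1)) := fun i hi =>
    hZcov i hi _ _ (by linarith [hM1 i]) le_rfl (hM2 i)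
  set t : ℕ → ℝ := fun j => if j = 0 then 0 else if j ≤ K then M (j - 1) else 1 with ht
  have htz : t 0 = 0 := by simp [ht]
  have htK : t (K + 1) = 1 := by simp [ht]
  have hts : ∀ i < K, t (i + 1) = M i := fun i hi => by
    simp only [ht]
    rw [if_neg (Nat.succ_ne_zero i), if_pos (Nat.succ_le_of_lt hi), Nat.add_sub_cancel]
  have hcases : ∀ j < K + 1, (t j < t (j + 1) ∧ t (j + 1) - t j ≤ 1 / K ∧
      Icc (t j) (t (j + 1)) ⊆ Icc 0 1) ∧
      MapsTo Z (Icc (t j) (t (j + 1))) (Icc (l j) (r j)) ∧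
      Icc (l j) (r j) ⊆ Z '' Icc (t j) (t (j + 1)) := by
    intro j hj
    rcases j with _ | i
    · have e1 := hM1 0
      have e2 := hM2 0
      have hl0 : l 0 = A 0 := rfl
      have hr0 : r 0 = A (0 + 1) := by simp only [hr]; rw [min_eq_left (by omega)]
      have e3 := hA01 (0 + 1) hK
      have e4 := hAs 0
      rw [hts 0 hK, show t 0 = A 0 from htz.trans hA0.symm, hl0, hr0]
      exact ⟨⟨by linarith, by linarith, Icc_subset_Icc hA0.ge (by linarith [e3.2])⟩,
        fun x hx => hZmaps 0 hK ⟨hx.1, by linarith [hx.2]⟩, hL1 0 hK⟩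
    · have hi : i < K := by omega
      have e1 := hM1 i
      have e2 := hM2 i
      have e3 := hA01 i hi.le
      have e4 := hAs i
      have hli : l (i + 1) = A i := rfl
      rw [hts i hi, hli]
      rcases Nat.lt_or_ge (i + 1) K with hi1 | hi1
      · have hri : r (i + 1) = A (i + 1 + 1) := by simp only [hr]; rw [min_eq_left (by omega)]
        have e5 := hM1 (i + 1)
        have e6 := hM2 (i + 1)
        have e7 := hA01 (i + 1 + 1) hi1
        have e8 := hMs i
        have e9 := hAs (i + 1)
        rw [hts (i + 1) hi1, hri]
        refine ⟨⟨by linarith, by linarith, Icc_subset_Icc (by linarith [e3.1])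
          (by linarith [e7.2])⟩, fun x hx => ?_, fun w hw => ?_⟩
        · rcases le_total x (A (i + 1)) with h | h
          · have := hZmaps i hi (show x ∈ _ from ⟨by linarith [hx.1], h⟩)
            exact ⟨this.1, by linarith [this.2]⟩
          · have := hZmaps (i + 1) hi1 (show x ∈ _ from ⟨h, by linarith [hx.2]⟩)
            exact ⟨by linarith [this.1], this.2⟩
        · rcases le_total w (A (i + 1)) with h | h
          · obtain ⟨x, hx, rfl⟩ := hR1 i hi ⟨hw.1, h⟩
            exact ⟨x, ⟨hx.1, by linarith [hx.2]⟩, rfl⟩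
          · obtain ⟨x, hx, rfl⟩ := hL1 (i + 1) hi1 ⟨h, hw.2⟩
            exact ⟨x, ⟨by linarith [hx.1], hx.2⟩, rfl⟩
      · obtain rfl : K = i + 1 := by omega
        have hri : r (i + 1) = A (i + 1) := by simp only [hr]; rw [min_eq_right (by omega)]
        rw [hri, show t (i + 1 + 1) = A (i + 1) from htK.trans hAK.symm]
        exact ⟨⟨by linarith, by linarith, Icc_subset_Icc (by linarith [e3.1]) hAK.le⟩,
          fun x hx => hZmaps i hi ⟨by linarith [hx.1], hx.2⟩, hR1 i hi⟩
  have hcomp : ∀ x ∈ Icc (0 : ℝ) 1, realExt (f.comp z) x = realExt f (Z x) := fun x hx => by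
    lift x to unitInterval using hx
    rw [← hzZ, realExt_coe, realExt_coe, ContinuousMap.comp_apply]
  refine ⟨z, hz, fun x => ?_, t, fun i => realExt f (p i), fun i => realExt f (q i), htz, htK,
    fun i hi => (hcases i hi).1.1, fun i hi => (hcases i hi).1.2.1, fun i hi => ?_,
    fun i hi x hx => ?_, fun i hi => ?_, fun i hi => ?_, fun i hi j hj hj0 => ?_,
    fun i hi j hj hj0 => ?_⟩
  · obtain ⟨i, hi, hxi⟩ := hcell x x.2
    have hZx := hZmaps i hi hxi
    rw [Subtype.dist_eq, hzZ]
    exact (Real.dist_le_of_mem_Icc hZx hxi).trans (by rw [hAs]; linarith)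
  · obtain ⟨hp, hq, hw⟩ := hpq i hi
    have hSi := hS i hi
    obtain ⟨x, hx, hne⟩ := exists_realExt_ne_of_mem_CLam hf
      (hSi (left_mem_Icc.2 (hlr i hi).le)).1 (hlr i hi)
      (hSi (right_mem_Icc.2 (hlr i hi).le)).2 (realExt f (p i))
    exact ((hw x hx).1.lt_of_ne hne.symm).trans_le (hw x hx).2
  · rw [hcomp x ((hcases i hi).1.2.2 hx)]
    exact (hpq i hi).2.2 _ ((hcases i hi).2.1 hx)
  · obtain ⟨x, hx, hxp⟩ := (hcases i hi).2.2 (hpq i hi).1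
    exact ⟨x, hx, by rw [hcomp x ((hcases i hi).1.2.2 hx), hxp]⟩
  · obtain ⟨x, hx, hxp⟩ := (hcases i hi).2.2 (hpq i hi).2.1
    exact ⟨x, hx, by rw [hcomp x ((hcases i hi).1.2.2 hx), hxp]⟩
  · obtain ⟨k, rfl⟩ := Nat.exists_eq_add_of_le' hj0
    have hk : k < K := by omega
    rw [hts k hk]
    exact fun h => (hs i hi k hk).1 (hMeq k _ h).symm
  · obtain ⟨k, rfl⟩ := Nat.exists_eq_add_of_le' hj0
    have hk : k < K := by omega
    rw [hts k hk]
    exact fun h => (hs i hi k hk).2 (hMeq k _ h).symm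

theorem dense_interior_periodicShadowingAt {ε : ℝ} (hε : 0 < ε) :
    Dense (interior {f : CLam | PeriodicShadowingAt f.1 ε}) := by
  rw [Metric.dense_iff]
  rintro ⟨f, hf⟩ η hη
  obtain ⟨κ, hκ, hfκ⟩ := Metric.uniformContinuous_iff.1
    (CompactSpace.uniformContinuous_of_continuous f.continuous) (η / 2) (half_pos hη)
  set μ := min ε (κ / 2) with hμ
  have hμ0 : 0 < μ := lt_min hε (half_pos hκ)
  obtain ⟨K, hK, hKμ⟩ : ∃ K : ℕ, 0 < K ∧ 1 / (K : ℝ) < μ := by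
    obtain ⟨n, hn⟩ := exists_nat_one_div_lt hμ0
    exact ⟨n + 1, Nat.succ_pos n, by exact_mod_cast hn⟩
  obtain ⟨z₁, hz₁, hz₁d, t, c, d, ht0, htN, ht, hmesh, hcd, hmaps, hl, hu, hct, hdt⟩ :=
    exists_fold_generic_partition hf hK
  obtain ⟨z₂, hz₂, hz₂d, θ, hθ, hg⟩ := periodicShadowingAt_near_of_partition (ε := μ)
    (Nat.succ_pos _) ht0 htN ht (fun i hi => (hmesh i hi).trans_lt hKμ) hcd hmaps hl hu hct hdt
  refine ⟨⟨(f.comp z₁).comp z₂, comp_mem_CLam (comp_mem_CLam hf hz₁) hz₂⟩, ?_, ?_⟩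
  · have hclose : ∀ x, dist (((f.comp z₁).comp z₂) x) (f x) ≤ η / 2 := fun x => by
      have h1 := hz₁d (z₂ x)
      have h2 := hz₂d x
      have h3 := dist_triangle (z₁ (z₂ x)) (z₂ x) x
      have h4 : μ ≤ κ / 2 := min_le_right _ _
      exact (hfκ (show dist (z₁ (z₂ x)) x < κ by linarith)).le
    exact ((ContinuousMap.dist_le (half_pos hη).le).2 hclose).trans_lt (half_lt_self hη)
  · rw [mem_interior_iff_mem_nhds, Metric.mem_nhds_iff]
    refine ⟨θ, hθ, fun g hgθ => ?_⟩
    obtain ⟨δ, hδ, h⟩ := hg g.1 hgθ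
    refine ⟨δ, hδ, fun y hy hyp => ?_⟩
    obtain ⟨x, hx, hxy⟩ := h y hy hyp
    exact ⟨x, hx, fun k => (hxy k).trans_le (min_le_left _ _)⟩

theorem periodic_shadowing_generic :
    ∃ R : Set ↥CLam, R ∈ residual ↥CLam ∧ ∀ f ∈ R, PeriodicShadowing (⇑f.1) := by
  refine ⟨⋂ n : ℕ, interior {f : CLam | PeriodicShadowingAt f.1 (1 / ((n : ℝ) + 1))},
    countable_iInter_mem.2 fun n => residual_of_dense_open isOpen_interior
      (dense_interior_periodicShadowingAt (by positivity)), fun f hf ε hε => ?_⟩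
  obtain ⟨n, hn⟩ := exists_nat_one_div_lt hε
  obtain ⟨δ, hδ, h⟩ := interior_subset (mem_iInter.1 hf n)
  refine ⟨δ, hδ, fun y hy hyp => ?_⟩
  obtain ⟨x, hx, hxy⟩ := h y hy hyp
  exact ⟨x, hx, fun k => (hxy k).trans hn⟩
end
end

section
/- For each integer k ≥ 1, the set of maps g ∈ C_λ(I) such that g is piecewise affine, Per(g,k) ≠ ∅, and every point of Fix(g,k) is a transverse periodic point of g, is dense in C_λ(I). -/
open MeasureTheory Set Metric Filter Topology

noncomputable section

/-- `g` is piecewise affine: there is a finite partition `0 = t 0 < t 1 < … < t m = 1`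
of `[0,1]` such that `g` is affine on each piece. -/
def PiecewiseAffine (g : C(unitInterval, unitInterval)) : Prop :=
  ∃ (m : ℕ) (t : ℕ → ℝ), t 0 = 0 ∧ t m = 1 ∧ (∀ j < m, t j < t (j + 1)) ∧
    ∀ j < m, ∃ a b : ℝ, ∀ x : unitInterval,
      t j ≤ (x : ℝ) → (x : ℝ) ≤ t (j + 1) → (g x : ℝ) = a * (x : ℝ) + b

/-- `p` is a transverse periodic point of `g` for the power `k`. -/
def TransversePt (g : unitInterval → unitInterval) (k : ℕ) (p : unitInterval) : Prop :=
  ∃ a₁ a₂ c₁ c₂ : ℝ, 0 ≤ a₁ ∧ a₁ < a₂ ∧ a₂ ≤ c₁ ∧ c₁ < c₂ ∧ c₂ ≤ 1 ∧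
    a₂ ≤ (p : ℝ) ∧ (p : ℝ) ≤ c₁ ∧
    (∀ x : unitInterval, a₂ ≤ (x : ℝ) → (x : ℝ) ≤ c₁ → g^[k] x = x) ∧
    ((∀ x : unitInterval, a₁ < (x : ℝ) → (x : ℝ) < a₂ → (x : ℝ) < (g^[k] x : ℝ)) ∧
       (∀ x : unitInterval, c₁ < (x : ℝ) → (x : ℝ) < c₂ → ((g^[k] x : ℝ) < (x : ℝ))) ∨
     (∀ x : unitInterval, a₁ < (x : ℝ) → (x : ℝ) < a₂ → ((g^[k] x : ℝ) < (x : ℝ))) ∧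
       (∀ x : unitInterval, c₁ < (x : ℝ) → (x : ℝ) < c₂ → (x : ℝ) < (g^[k] x : ℝ)))

/-- The `l`-th closed cell of the uniform grid of mesh `1 / N`. -/
def gridCell (N l : ℕ) : Set ℝ := Icc ((l : ℝ) / N) (((l : ℝ) + 1) / N)

/-- `g` is affine on each piece of a finite subdivision of `[a, b]`. -/
inductive AffinePieces (g : ℝ → ℝ) (a : ℝ) : ℝ → Prop
  | single (b s c : ℝ) : a < b → (∀ x ∈ Icc a b, g x = s * x + c) → AffinePieces g a b
  | snoc (b d s c : ℝ) : AffinePieces g a b → b < d → (∀ x ∈ Icc b d, g x = s * x + c) →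
      AffinePieces g a d

namespace AffinePieces

variable {g h : ℝ → ℝ} {a b d : ℝ}

theorem lt (H : AffinePieces g a b) : a < b := by
  induction H with
  | single b s c hab _ => exact hab
  | snoc b d s c _ hbd _ ih => exact ih.trans hbd

theorem congr (H : AffinePieces g a b) (hgh : EqOn h g (Icc a b)) : AffinePieces h a b := by
  induction H with
  | single b s c hab haff =>
    exact .single b s c hab fun x hx => (hgh hx).trans (haff x hx)
  | snoc b d s c H hbd haff ih =>
    refine .snoc b d s c (ih fun x hx => hgh ⟨hx.1, hx.2.trans hbd.le⟩) hbd fun x hx => ?_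
    exact (hgh ⟨H.lt.le.trans hx.1, hx.2⟩).trans (haff x hx)

theorem trans (H : AffinePieces g a b) (H' : AffinePieces g b d) : AffinePieces g a d := by
  induction H' with
  | single d s c hbd haff => exact .snoc b d s c H hbd haff
  | snoc d e s c _ hde haff ih => exact .snoc d e s c ih hde haff

theorem exists_subdivision (H : AffinePieces g a b) :
    ∃ (m : ℕ) (t : ℕ → ℝ), t 0 = a ∧ t m = b ∧ (∀ j < m, t j < t (j + 1)) ∧
      ∀ j < m, ∃ s c : ℝ, ∀ x ∈ Icc (t j) (t (j + 1)), g x = s * x + c := by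
  induction H with
  | single b s c hab haff =>
    refine ⟨1, fun n => if n = 0 then a else b, by simp, by simp, ?_, ?_⟩
    · intro j hj
      obtain rfl : j = 0 := by omega
      simpa using hab
    · intro j hj
      obtain rfl : j = 0 := by omega
      exact ⟨s, c, by simpa using haff⟩
  | snoc b d s c H hbd haff ih =>
    obtain ⟨m, t, h0, hm, hlt, hg⟩ := ih
    have key : ∀ j ≤ m, Function.update t (m + 1) d j = t j := fun j hj =>
      Function.update_of_ne (by omega) _ _
    refine ⟨m + 1, Function.update t (m + 1) d, ?_, by simp, ?_, ?_⟩
    · rw [key 0 (Nat.zero_le _), h0]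
    · intro j hj
      rcases Nat.lt_succ_iff_lt_or_eq.1 hj with hj | rfl
      · rw [key j hj.le, key (j + 1) hj]
        exact hlt j hj
      · rw [key j le_rfl, Function.update_self, hm]
        exact hbd
    · intro j hj
      rcases Nat.lt_succ_iff_lt_or_eq.1 hj with hj | rfl
      · rw [key j hj.le, key (j + 1) hj]
        exact hg j hj
      · rw [key j le_rfl, Function.update_self, hm]
        exact ⟨s, c, haff⟩

end AffinePieces

/-- Along the filter `F`, the slopes of `g` at `x` have sign `σ` and modulus larger than `1`. -/
def ExpandsAlong (σ : ℝ) (F : Filter ℝ) (g : ℝ → ℝ) (x : ℝ) : Prop :=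
  ∀ᶠ y in F, 1 < σ * slope g x y

/-- Near `x` the map `g` expands distances to `x` and does not fold. -/
def LocallyExpands (g : ℝ → ℝ) (x : ℝ) : Prop :=
  ∃ σ : ℝ, (σ = 1 ∨ σ = -1) ∧ ExpandsAlong σ (𝓝[≠] x) g x

theorem ExpandsAlong.congr {σ : ℝ} {F : Filter ℝ} {g h : ℝ → ℝ} {x : ℝ} {s : Set ℝ}
    (H : ExpandsAlong σ F g x) (hs : s ∈ F) (hgh : EqOn h g s) (hx : x ∈ s) :
    ExpandsAlong σ F h x := by
  filter_upwards [H, hs] with y hy hys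
  rwa [slope_def_field, hgh hx, hgh hys, ← slope_def_field]

/-- `g` is a piecewise affine path over `[a, b]` from the grid vertex `u / N` to the grid vertex
`v / N` which folds only at grid values, leaves `a` and reaches `b` with slopes of signs `σ₁` and
`σ₂`, and spends time `μ l`, uniformly distributed, in the `l`-th grid cell. -/
structure GridPath (N : ℕ) (a b : ℝ) (u v : ℕ) (σ₁ σ₂ : ℝ) (μ : ℕ → ℝ) (g : ℝ → ℝ) : Prop where
  lt : a < b
  cont : ContinuousOn g (Icc a b)
  left : g a = u / N
  right : g b = v / N
  right_le : v ≤ N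
  affine : AffinePieces g a b
  nonneg : ∀ l, 0 ≤ μ l
  vol : ∀ A : Set ℝ, volume (Ioc a b ∩ g ⁻¹' A) =
    ∑ l ∈ Finset.range N, ENNReal.ofReal (N * μ l) * volume (A ∩ gridCell N l)
  inner : ∀ x ∈ Ioo a b, LocallyExpands g x ∨ ∃ j : ℕ, j ≤ N ∧ g x = j / N
  enter : ExpandsAlong σ₁ (𝓝[>] a) g a
  exit : ExpandsAlong σ₂ (𝓝[<] b) g b
  branch : ∀ l, 0 < μ l → ∃ ψ : ℝ → ℝ, ContinuousOn ψ (gridCell N l) ∧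
    ∀ y ∈ gridCell N l, ψ y ∈ Icc a b ∧ g (ψ y) = y
  range : ∀ x ∈ Icc a b, ∃ l < N, 0 < μ l ∧ g x ∈ gridCell N l

namespace GridPath

variable {N u v w : ℕ} {a b c σ₁ σ₂ σ₃ σ₄ : ℝ} {μ ν : ℕ → ℝ} {g h : ℝ → ℝ}

theorem congr (H : GridPath N a b u v σ₁ σ₂ μ g) (hgh : EqOn h g (Icc a b)) :
    GridPath N a b u v σ₁ σ₂ μ h where
  lt := H.lt
  cont := H.cont.congr hgh
  left := (hgh ⟨le_rfl, H.lt.le⟩).trans H.left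
  right := (hgh ⟨H.lt.le, le_rfl⟩).trans H.right
  right_le := H.right_le
  affine := H.affine.congr hgh
  nonneg := H.nonneg
  vol A := by
    rw [← H.vol A]
    congr 1
    ext x
    simp only [mem_inter_iff, mem_preimage, and_congr_right_iff]
    intro hx
    rw [hgh ⟨hx.1.le, hx.2⟩]
  inner x hx := by
    have hx' := hgh ⟨hx.1.le, hx.2.le⟩
    rcases H.inner x hx with ⟨σ, hσ, hE⟩ | hj
    · exact .inl ⟨σ, hσ, hE.congr (mem_nhdsWithin_of_mem_nhds (Icc_mem_nhds hx.1 hx.2)) hgh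
        ⟨hx.1.le, hx.2.le⟩⟩
    · exact .inr (by rwa [hx'])
  enter := H.enter.congr (Icc_mem_nhdsGT H.lt) hgh ⟨le_rfl, H.lt.le⟩
  exit := H.exit.congr (Icc_mem_nhdsLT H.lt) hgh ⟨H.lt.le, le_rfl⟩
  branch l hl := by
    obtain ⟨ψ, hψ, hψ'⟩ := H.branch l hl
    exact ⟨ψ, hψ, fun y hy => ⟨(hψ' y hy).1, (hgh (hψ' y hy).1).trans (hψ' y hy).2⟩⟩
  range x hx := by
    rw [hgh hx]
    exact H.range x hx

theorem locallyExpands_joint (H : GridPath N a b u v σ₁ σ₂ μ g)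
    (H' : GridPath N b c v w σ₂ σ₄ ν g) (hσ : σ₂ = 1 ∨ σ₂ = -1) : LocallyExpands g b := by
  refine ⟨σ₂, hσ, ?_⟩
  rw [ExpandsAlong, ← nhdsLT_sup_nhdsGT, eventually_sup]
  exact ⟨H.exit, H'.enter⟩

theorem glue (H : GridPath N a b u v σ₁ σ₂ μ g) (H' : GridPath N b c v w σ₃ σ₄ ν g) :
    GridPath N a c u w σ₁ σ₄ (fun l => μ l + ν l) g where
  lt := H.lt.trans H'.lt
  cont := by
    rw [← Icc_union_Icc_eq_Icc H.lt.le H'.lt.le]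
    exact H.cont.union_of_isClosed H'.cont isClosed_Icc isClosed_Icc
  left := H.left
  right := H'.right
  right_le := H'.right_le
  affine := H.affine.trans H'.affine
  nonneg l := add_nonneg (H.nonneg l) (H'.nonneg l)
  vol A := by
    have h1 : Ioc a c ∩ g ⁻¹' A ∩ Iic b = Ioc a b ∩ g ⁻¹' A := by
      ext x
      have := H'.lt
      simp only [mem_inter_iff, mem_Ioc, mem_preimage, mem_Iic]
      constructor
      · rintro ⟨⟨⟨h1, h2⟩, h3⟩, h4⟩
        exact ⟨⟨h1, h4⟩, h3⟩
      · rintro ⟨⟨h1, h2⟩, h3⟩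
        exact ⟨⟨⟨h1, h2.trans this.le⟩, h3⟩, h2⟩
    have h2 : (Ioc a c ∩ g ⁻¹' A) \ Iic b = Ioc b c ∩ g ⁻¹' A := by
      ext x
      have := H.lt
      simp only [mem_inter_iff, mem_Ioc, mem_preimage, mem_Iic, Set.mem_sdiff, not_le]
      constructor
      · rintro ⟨⟨⟨h1, h2⟩, h3⟩, h4⟩
        exact ⟨⟨h4, h2⟩, h3⟩
      · rintro ⟨⟨h1, h2⟩, h3⟩
        exact ⟨⟨⟨this.trans h1, h2⟩, h3⟩, h1⟩
    rw [← measure_inter_add_sdiff _ (measurableSet_Iic (a := b)), h1, h2, H.vol, H'.vol,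
      ← Finset.sum_add_distrib]
    refine Finset.sum_congr rfl fun l _ => ?_
    rw [mul_add, ENNReal.ofReal_add (mul_nonneg N.cast_nonneg (H.nonneg l))
      (mul_nonneg N.cast_nonneg (H'.nonneg l)), add_mul]
  inner x hx := by
    rcases lt_trichotomy x b with hxb | rfl | hxb
    · exact H.inner x ⟨hx.1, hxb⟩
    · exact .inr ⟨v, H.right_le, H.right⟩
    · exact H'.inner x ⟨hxb, hx.2⟩
  enter := H.enter
  exit := H'.exit
  branch l hl := by
    rcases (H.nonneg l).eq_or_lt with h0 | h0
    · obtain ⟨ψ, hψ, hψ'⟩ := H'.branch l (by simpa [← h0] using hl)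
      exact ⟨ψ, hψ, fun y hy => ⟨Icc_subset_Icc_left H.lt.le (hψ' y hy).1, (hψ' y hy).2⟩⟩
    · obtain ⟨ψ, hψ, hψ'⟩ := H.branch l h0
      exact ⟨ψ, hψ, fun y hy => ⟨Icc_subset_Icc_right H'.lt.le (hψ' y hy).1, (hψ' y hy).2⟩⟩
  range x hx := by
    rcases le_total x b with hxb | hxb
    · obtain ⟨l, hl, hμ, hg⟩ := H.range x ⟨hx.1, hxb⟩
      exact ⟨l, hl, add_pos_of_pos_of_nonneg hμ (H'.nonneg l), hg⟩
    · obtain ⟨l, hl, hμ, hg⟩ := H'.range x ⟨hxb, hx.2⟩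
      exact ⟨l, hl, add_pos_of_nonneg_of_pos (H.nonneg l) hμ, hg⟩

theorem exists_append (H : ∃ g, GridPath N a b u v σ₁ σ₂ μ g)
    (H' : ∃ g, GridPath N b c v w σ₃ σ₄ ν g) :
    ∃ g, GridPath N a c u w σ₁ σ₄ (fun l => μ l + ν l) g := by
  obtain ⟨g, hg⟩ := H
  obtain ⟨h, hh⟩ := H'
  refine ⟨fun x => if x ≤ b then g x else h x, (hg.congr ?_).glue (hh.congr ?_)⟩
  · intro x hx
    simp [hx.2]
  · intro x hx
    rcases hx.1.eq_or_lt with rfl | hbx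
    · simp [hg.right, hh.left]
    · simp [hbx.not_ge]

theorem exists_edge {l : ℕ} {σ τ : ℝ} (hl : l < N) (hτ : 0 < τ) (hτN : N * τ < 1)
    (huv : u = l ∧ v = l + 1 ∧ σ = 1 ∨ u = l + 1 ∧ v = l ∧ σ = -1) (a : ℝ) :
    ∃ g, GridPath N a (a + τ) u v σ σ (fun i => if i = l then τ else 0) g := by
  have hN : (0 : ℝ) < N := by exact_mod_cast (Nat.zero_le l).trans_lt hl
  have hσ : σ * σ = 1 := by rcases huv with ⟨_, _, rfl⟩ | ⟨_, _, rfl⟩ <;> norm_num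
  have hv : (v : ℝ) = u + σ := by
    rcases huv with ⟨rfl, rfl, rfl⟩ | ⟨rfl, rfl, rfl⟩ <;> push_cast <;> ring
  have hvN : v ≤ N := by omega
  set s : ℝ := σ / (N * τ) with hs
  have hNτ : 0 < N * τ := mul_pos hN hτ
  have hσ0 : σ ≠ 0 := by rintro rfl; norm_num at hσ
  have hs0 : s ≠ 0 := div_ne_zero hσ0 hNτ.ne'
  set g : ℝ → ℝ := fun x => s * x + (u / N - s * a) with hg
  have hslope : ∀ x y, y ≠ x → 1 < σ * slope g x y := by
    intro x y hxy
    have hxy' : y - x ≠ 0 := sub_ne_zero.2 hxy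
    have : slope g x y = s := by
      rw [slope_def_field]
      simp only [hg]
      field_simp
      ring
    rw [this, hs, ← mul_div_assoc, hσ]
    exact (one_lt_div hNτ).2 hτN
  have hmem : ∀ x, x ∈ Icc a (a + τ) ↔ g x ∈ gridCell N l := by
    intro x
    have hgx : g x = u / N + σ * ((x - a) / τ) / N := by
      simp only [hg, hs]
      field_simp
      ring
    have e1 : x ∈ Icc a (a + τ) ↔ 0 ≤ (x - a) / τ ∧ (x - a) / τ ≤ 1 := by
      rw [mem_Icc, le_div_iff₀ hτ, div_le_iff₀ hτ]
      constructor <;> rintro ⟨h1, h2⟩ <;> constructor <;> linarith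
    rw [e1, hgx, gridCell, mem_Icc, ← add_div, div_le_div_iff_of_pos_right hN,
      div_le_div_iff_of_pos_right hN]
    rcases huv with ⟨rfl, rfl, rfl⟩ | ⟨rfl, rfl, rfl⟩ <;> push_cast <;>
      constructor <;> rintro ⟨h1, h2⟩ <;> constructor <;> linarith
  have hcont : Continuous g := by fun_prop
  have hlt : a < a + τ := by linarith
  refine ⟨g, ⟨hlt, hcont.continuousOn, ?_, ?_, hvN, ?_, ?_, ?_, ?_, ?_, ?_, ?_, ?_⟩⟩
  · simp only [hg]; ring
  · simp only [hg, hs, hv]; field_simp; ring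
  · exact .single _ s _ hlt fun x _ => rfl
  · intro i; split_ifs <;> simp [hτ.le]
  · intro A
    have h1 : (Ioc a (a + τ) ∩ g ⁻¹' A : Set ℝ) =ᵐ[volume] (Icc a (a + τ) ∩ g ⁻¹' A : Set ℝ) :=
      Ioc_ae_eq_Icc.inter (ae_eq_refl _)
    have h2 : Icc a (a + τ) ∩ g ⁻¹' A = g ⁻¹' (A ∩ gridCell N l) := by
      ext x
      rw [mem_inter_iff, hmem, mem_preimage, mem_preimage, mem_inter_iff, and_comm]
    have h3 : g ⁻¹' (A ∩ gridCell N l) =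
        (s * ·) ⁻¹' ((· + (u / N - s * a)) ⁻¹' (A ∩ gridCell N l)) := rfl
    have h4 : |s⁻¹| = N * τ := by
      have : |σ| = 1 := by rcases huv with ⟨_, _, rfl⟩ | ⟨_, _, rfl⟩ <;> norm_num
      rw [hs, inv_div, abs_div, this, abs_of_pos hNτ, div_one]
    rw [measure_congr h1, h2, h3, Real.volume_preimage_mul_left hs0, measure_preimage_add_right,
      h4, Finset.sum_eq_single l]
    · simp
    · intro i _ hi; simp [hi]
    · intro h; exact absurd (Finset.mem_range.2 hl) h
  · intro x _
    refine .inl ⟨σ, by rcases huv with ⟨_, _, rfl⟩ | ⟨_, _, rfl⟩ <;> simp, ?_⟩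
    filter_upwards [self_mem_nhdsWithin] with y hy using hslope x y hy
  · filter_upwards [self_mem_nhdsWithin] with y hy using hslope _ y (ne_of_gt hy)
  · filter_upwards [self_mem_nhdsWithin] with y hy using hslope _ y (ne_of_lt hy)
  · intro i hi
    obtain rfl : i = l := by
      by_contra hne
      simp [hne] at hi
    have hinv : ∀ y, g (s⁻¹ * (y - (u / N - s * a))) = y := by
      intro y
      simp only [hg, mul_inv_cancel_left₀ hs0]
      ring
    refine ⟨fun y => s⁻¹ * (y - (u / N - s * a)), by fun_prop, fun y hy => ⟨?_, hinv y⟩⟩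
    rw [hmem, hinv]
    exact hy
  · intro x hx
    exact ⟨l, hl, by simpa using hτ, (hmem x).1 hx⟩

end GridPath

/-- From every starting time there is a grid path from `u / N` to `v / N` with occupation
times `μ`. -/
def GridRoute (N u v : ℕ) (σ₁ σ₂ : ℝ) (μ : ℕ → ℝ) : Prop :=
  ∀ a, ∃ g, GridPath N a (a + ∑ l ∈ Finset.range N, μ l) u v σ₁ σ₂ μ g

namespace GridRoute

variable {N u v w p q : ℕ} {σ₁ σ₂ σ₃ σ₄ : ℝ} {μ ν τ : ℕ → ℝ}

theorem congr (H : GridRoute N u v σ₁ σ₂ μ) (h : ∀ l, ν l = μ l) :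
    GridRoute N u v σ₁ σ₂ ν := by
  rwa [funext h]

theorem append (H : GridRoute N u v σ₁ σ₂ μ) (H' : GridRoute N v w σ₃ σ₄ ν) :
    GridRoute N u w σ₁ σ₄ (fun l => μ l + ν l) := by
  intro a
  rw [Finset.sum_add_distrib, ← add_assoc]
  exact GridPath.exists_append (H a) (H' _)

theorem edge {l : ℕ} {σ t : ℝ} (hl : l < N) (ht : 0 < t ∧ N * t < 1)
    (huv : u = l ∧ v = l + 1 ∧ σ = 1 ∨ u = l + 1 ∧ v = l ∧ σ = -1) :
    GridRoute N u v σ σ (fun i => if i = l then t else 0) := by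
  intro a
  rw [Finset.sum_ite_eq', if_pos (Finset.mem_range.2 hl)]
  exact GridPath.exists_edge hl ht.1 ht.2 huv a

theorem ascent (hpq : p < q) (hq : q ≤ N) (hτ : ∀ l, p ≤ l → l < q → 0 < τ l ∧ N * τ l < 1) :
    GridRoute N p q 1 1 (fun l => if p ≤ l ∧ l < q then τ l else 0) := by
  induction q, Nat.succ_le_iff.2 hpq using Nat.le_induction with
  | base =>
    refine (edge hq (hτ p le_rfl p.lt_succ_self) (.inl ⟨rfl, rfl, rfl⟩)).congr fun l => ?_
    by_cases hl : l = p
    · simp [hl]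
    · rw [if_neg (by omega), if_neg hl]
  | succ q hpq' ih =>
    refine ((ih hpq' (by omega) fun l h1 h2 => hτ l h1 (by omega)).append
      (edge hq (hτ q (by omega) q.lt_succ_self) (.inl ⟨rfl, rfl, rfl⟩))).congr fun l => ?_
    by_cases hl : l = q
    · subst hl
      rw [if_pos (by omega), if_neg (by omega), if_pos rfl, zero_add]
    · simp only [hl, if_false, add_zero]
      exact if_congr (by omega) rfl rfl

theorem descent (hpq : p < q) (hq : q ≤ N) (hτ : ∀ l, p ≤ l → l < q → 0 < τ l ∧ N * τ l < 1) :
    GridRoute N q p (-1) (-1) (fun l => if p ≤ l ∧ l < q then τ l else 0) := by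
  induction q, Nat.succ_le_iff.2 hpq using Nat.le_induction with
  | base =>
    refine (edge hq (hτ p le_rfl p.lt_succ_self) (.inr ⟨rfl, rfl, rfl⟩)).congr fun l => ?_
    by_cases hl : l = p
    · simp [hl]
    · rw [if_neg (by omega), if_neg hl]
  | succ q hpq' ih =>
    refine ((edge hq (hτ q (by omega) q.lt_succ_self) (.inr ⟨rfl, rfl, rfl⟩)).append
      (ih hpq' (by omega) fun l h1 h2 => hτ l h1 (by omega))).congr fun l => ?_
    by_cases hl : l = q
    · subst hl
      rw [if_pos (by omega), if_pos rfl, if_neg (by omega), add_zero]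
    · simp only [hl, if_false, zero_add]
      exact if_congr (by omega) rfl rfl

/-- Any occupation times supported on an interval of cells are realised by a path which starts
and ends at given interior vertices of that interval, with negative slope at both ends. -/
theorem of_support {lo hi : ℕ} (hlu : lo < u) (huh : u < hi) (hlv : lo < v) (hvh : v < hi)
    (hi_le : hi ≤ N) (hpos : ∀ l, lo ≤ l → l < hi → 0 < μ l) (hle : ∀ l, N * μ l ≤ 1)
    (hzero : ∀ l, ¬(lo ≤ l ∧ l < hi) → μ l = 0) :
    GridRoute N u v (-1) (-1) μ := by
  set c : ℕ → ℝ := fun l => (if l < u then 1 else 0) + 3 + (if v ≤ l then 1 else 0) with hc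
  have hc3 : ∀ l, 3 ≤ c l := by
    intro l
    simp only [hc]
    split_ifs <;> norm_num
  have hτ : ∀ l, lo ≤ l → l < hi → 0 < μ l / c l ∧ N * (μ l / c l) < 1 := by
    intro l h1 h2
    have h3 := hc3 l
    have hcl : 0 < c l := by linarith
    refine ⟨div_pos (hpos l h1 h2) hcl, ?_⟩
    rw [← mul_div_assoc, div_lt_one hcl]
    linarith [hle l]
  have full : lo < hi := hlu.trans huh
  refine ((((descent hlu (by omega) fun l h1 h2 => hτ l h1 (by omega)).append
    (ascent full hi_le hτ)).append (descent full hi_le hτ)).append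
    (ascent full hi_le hτ)).append (descent hvh hi_le fun l h1 h2 => hτ l (by omega) h2)
    |>.congr fun l => ?_
  have hcl : c l ≠ 0 := by linarith [hc3 l]
  by_cases hl : lo ≤ l ∧ l < hi
  · have key : μ l = c l * (μ l / c l) := (mul_div_cancel₀ _ hcl).symm
    generalize μ l / c l = t at key
    rw [key]
    simp only [hl, hc, and_true, true_and, if_true]
    split_ifs <;> ring
  · have hl1 : ¬(lo ≤ l ∧ l < u) := by omega
    have hl2 : ¬(v ≤ l ∧ l < hi) := by omega
    simp [hl, hl1, hl2, hzero l hl]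

end GridRoute

/-- Finitely many consecutive functions which agree at the common end points can be glued. -/
theorem exists_eqOn_Icc_of_agree {t : ℕ → ℝ} (ht : Monotone t) {G : ℕ → ℝ → ℝ}
    (hG : ∀ i, G i (t (i + 1)) = G (i + 1) (t (i + 1))) (n : ℕ) :
    ∃ g : ℝ → ℝ, ∀ i ≤ n, EqOn g (G i) (Icc (t i) (t (i + 1))) := by
  induction n with
  | zero =>
    refine ⟨G 0, fun i hi => ?_⟩
    obtain rfl : i = 0 := by omega
    exact fun x _ => rfl
  | succ n ih =>
    obtain ⟨g, hg⟩ := ih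
    refine ⟨fun x => if x ≤ t (n + 1) then g x else G (n + 1) x, fun i hi x hx => ?_⟩
    rcases Nat.lt_succ_iff_lt_or_eq.1 (Nat.lt_succ_of_le hi) with hi | rfl
    · have : x ≤ t (n + 1) := hx.2.trans (ht (by omega))
      simpa [this] using hg i (by omega) hx
    · rcases hx.1.eq_or_lt with rfl | hlt
      · simp only [le_refl, if_true]
        rw [hg n le_rfl ⟨ht (by omega), le_rfl⟩, hG]
      · simp [hlt.not_ge]

namespace GridPath

variable {N : ℕ} {μ : ℕ → ℕ → ℝ} {u : ℕ → ℕ}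

theorem exists_concat (hN : 0 < N) (hrow : ∀ i < N, ∑ l ∈ Finset.range N, μ i l = 1 / N)
    (H : ∀ i < N, GridRoute N (u i) (u (i + 1)) (-1) (-1) (μ i)) :
    ∃ g : ℝ → ℝ, ∀ i < N, GridPath N ((i : ℝ) / N) (((i : ℝ) + 1) / N) (u i) (u (i + 1))
      (-1) (-1) (μ i) g := by
  have hpath : ∀ i, ∃ g, i < N → GridPath N ((i : ℝ) / N) (((i : ℝ) + 1) / N) (u i) (u (i + 1))
      (-1) (-1) (μ i) g := by
    intro i
    by_cases hi : i < N
    · obtain ⟨g, hg⟩ := H i hi ((i : ℝ) / N)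
      refine ⟨g, fun _ => ?_⟩
      rwa [hrow i hi, ← add_div] at hg
    · exact ⟨0, fun h => absurd h hi⟩
  choose G hG using hpath
  have ht : Monotone fun n : ℕ => (n : ℝ) / N := fun a b hab => by
    dsimp only
    gcongr
  obtain ⟨g, hg⟩ := exists_eqOn_Icc_of_agree (t := fun n : ℕ => (n : ℝ) / N) ht
    (G := fun i => if i < N then G i else fun _ => (u N : ℝ) / N) (fun i => by
      rcases lt_trichotomy (i + 1) N with hi | hi | hi
      · have h1 := (hG i (by omega)).right
        have h2 := (hG (i + 1) hi).left
        push_cast at h1 h2 ⊢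
        rw [if_pos (by omega), if_pos hi, h1, h2]
      · have h1 := (hG i (by omega)).right
        push_cast at h1 ⊢
        rw [if_pos (by omega), if_neg (by omega), h1, hi]
      · rw [if_neg (by omega), if_neg (by omega)]) N
  refine ⟨g, fun i hi => (hG i hi).congr ?_⟩
  have := hg i hi.le
  simpa [hi] using this

theorem concat {g : ℝ → ℝ}
    (H : ∀ i < N, GridPath N ((i : ℝ) / N) (((i : ℝ) + 1) / N) (u i) (u (i + 1))
      (-1) (-1) (μ i) g) {n : ℕ} (hn : 0 < n) (hnN : n ≤ N) :
    GridPath N 0 ((n : ℝ) / N) (u 0) (u n) (-1) (-1) (fun l => ∑ i ∈ Finset.range n, μ i l) g := by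
  induction n, Nat.succ_le_iff.2 hn using Nat.le_induction with
  | base => simpa using H 0 (by omega)
  | succ n hn' ih =>
    simp only [Finset.sum_range_succ]
    push_cast
    exact (ih hn' (by omega)).glue (H n (by omega))

end GridPath

/-- A symmetric doubly stochastic matrix of size `N` whose support is the band of radius `R`. -/
theorem exists_bandMatrix (N R : ℕ) :
    ∃ A : ℕ → ℕ → ℝ, (∀ j l, 0 ≤ A j l) ∧ (∀ j l, A j l = A l j) ∧
      (∀ j < N, ∑ l ∈ Finset.range N, A j l = 1) ∧
      ∀ j l, 0 < A j l ↔ j ≤ l + R ∧ l ≤ j + R := by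
  set E : ℕ → ℕ → ℝ := fun j l => if j ≤ l + R ∧ l ≤ j + R then 1 / (2 * R + 1) else 0 with hE
  have hR : (0 : ℝ) < 2 * R + 1 := by positivity
  have hE0 : ∀ j l, 0 ≤ E j l := by
    intro j l
    simp only [hE]
    split_ifs <;> positivity
  have hsum : ∀ j, ∑ l ∈ Finset.range N, E j l ≤ 1 := by
    intro j
    have hsub : (Finset.range N).filter (fun l => j ≤ l + R ∧ l ≤ j + R) ⊆
        Finset.Icc (j - R) (j + R) := by
      intro l hl
      simp only [Finset.mem_filter, Finset.mem_Icc] at hl ⊢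
      omega
    have hcard : (((Finset.range N).filter (fun l => j ≤ l + R ∧ l ≤ j + R)).card : ℝ) ≤
        2 * R + 1 := by
      have h := Finset.card_le_card hsub
      rw [Nat.card_Icc] at h
      exact_mod_cast h.trans (by omega : j + R + 1 - (j - R) ≤ 2 * R + 1)
    simp only [hE]
    rw [← Finset.sum_filter, Finset.sum_const, nsmul_eq_mul, mul_one_div]
    exact (div_le_one hR).2 hcard
  set d : ℕ → ℝ := fun j => 1 - ∑ l ∈ Finset.range N, E j l with hd
  have hd0 : ∀ j, 0 ≤ d j := fun j => sub_nonneg.2 (hsum j)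
  refine ⟨fun j l => E j l + if j = l then d j else 0, ?_, ?_, ?_, ?_⟩
  · intro j l
    refine add_nonneg (hE0 j l) ?_
    split_ifs
    exacts [hd0 j, le_rfl]
  · intro j l
    by_cases h : j = l
    · rw [h]
    · have : ¬(l = j) := fun h' => h h'.symm
      simp only [h, this, if_false, hE, and_comm]
  · intro j hj
    rw [Finset.sum_add_distrib, Finset.sum_ite_eq, if_pos (Finset.mem_range.2 hj)]
    simp [hd]
  · intro j l
    by_cases h : j ≤ l + R ∧ l ≤ j + R
    · simp only [h, and_self, iff_true]
      refine add_pos_of_pos_of_nonneg ?_ ?_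
      · simp only [hE, h, and_self, if_true]
        positivity
      · split_ifs
        exacts [hd0 j, le_rfl]
    · have : ¬(j = l) := by omega
      simp [hE, h, this]

/-- The index of a grid cell of mesh `1 / N` containing `x`. -/
def cellIndex (N : ℕ) (x : unitInterval) : ℕ := min ⌊(N : ℝ) * x⌋₊ (N - 1)

section cellIndex

variable {N : ℕ}

theorem cellIndex_lt (hN : 0 < N) (x : unitInterval) : cellIndex N x < N := by
  unfold cellIndex
  omega

theorem measurable_cellIndex (N : ℕ) : Measurable (cellIndex N) := by
  unfold cellIndex
  fun_prop

theorem mem_gridCell_cellIndex (hN : 0 < N) (x : unitInterval) :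
    (x : ℝ) ∈ gridCell N (cellIndex N x) := by
  have hN' : (0 : ℝ) < N := by exact_mod_cast hN
  have h0 : (0 : ℝ) ≤ N * x := mul_nonneg hN'.le x.2.1
  rw [gridCell, mem_Icc, div_le_iff₀ hN', le_div_iff₀ hN', mul_comm (x : ℝ)]
  constructor
  · exact (Nat.cast_le.2 (min_le_left _ _)).trans (Nat.floor_le h0)
  · rcases le_total ⌊(N : ℝ) * x⌋₊ (N - 1) with h | h
    · rw [cellIndex, min_eq_left h]
      exact (Nat.lt_floor_add_one _).le
    · rw [cellIndex, min_eq_right h, Nat.cast_pred hN]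
      nlinarith [x.2.2]

theorem cellIndex_eq_of_mem_Ico {l : ℕ} {x : unitInterval} (hl : l < N)
    (hx : (x : ℝ) ∈ Ico ((l : ℝ) / N) (((l : ℝ) + 1) / N)) : cellIndex N x = l := by
  have hN' : (0 : ℝ) < N := by exact_mod_cast (Nat.zero_le l).trans_lt hl
  rw [mem_Ico, div_le_iff₀ hN', lt_div_iff₀ hN', mul_comm (x : ℝ)] at hx
  have : ⌊(N : ℝ) * x⌋₊ = l := (Nat.floor_eq_iff (l.cast_nonneg.trans hx.1)).2 hx
  rw [cellIndex, this]
  omega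

theorem measureReal_cellIndex_preimage {l : ℕ} (hl : l < N) :
    (volume : Measure unitInterval).real (cellIndex N ⁻¹' {l}) = 1 / N := by
  have hN : 0 < N := (Nat.zero_le l).trans_lt hl
  have hN' : (0 : ℝ) < N := by exact_mod_cast hN
  have hl' : (l : ℝ) + 1 ≤ N := by exact_mod_cast hl
  set p : unitInterval := ⟨(l : ℝ) / N, by positivity, (div_le_one hN').2 (by linarith)⟩ with hp
  set q : unitInterval := ⟨((l : ℝ) + 1) / N, by positivity, (div_le_one hN').2 hl'⟩ with hq
  have hval : ENNReal.ofReal ((q : ℝ) - p) = ENNReal.ofReal (1 / N) := by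
    congr 1
    simp only [hp, hq]
    ring
  have h1 : (volume : Measure unitInterval) (cellIndex N ⁻¹' {l}) = ENNReal.ofReal (1 / N) := by
    apply le_antisymm
    · rw [← hval, ← unitInterval.volume_Icc]
      refine measure_mono fun x hx => ?_
      have := mem_gridCell_cellIndex hN x
      rw [show cellIndex N x = l from hx] at this
      exact this
    · rw [← hval, ← unitInterval.volume_Ico]
      exact measure_mono fun x hx => cellIndex_eq_of_mem_Ico hl hx
  rw [measureReal_def, h1, ENNReal.toReal_ofReal (by positivity)]

end cellIndex

/-- The transition matrix of a measure-preserving map with respect to the uniform grid. -/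
theorem exists_transitionMatrix {f : C(unitInterval, unitInterval)} (hf : MeasPres f) {N : ℕ}
    (hN : 0 < N) :
    ∃ M : ℕ → ℕ → ℝ, (∀ i j, 0 ≤ M i j) ∧ (∀ i < N, ∑ j ∈ Finset.range N, M i j = 1 / N) ∧
      (∀ j < N, ∑ i ∈ Finset.range N, M i j = 1 / N) ∧
      ∀ i j, 0 < M i j → ∃ x : unitInterval, cellIndex N x = i ∧ cellIndex N (f x) = j := by
  have hc := measurable_cellIndex N
  have hcf : Measurable fun x => cellIndex N (f x) := hc.comp f.continuous.measurable
  have key : ∀ (S : Set unitInterval), MeasurableSet S → ∀ φ : unitInterval → ℕ, Measurable φ →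
      (∀ x, φ x < N) → ∑ j ∈ Finset.range N, (volume : Measure unitInterval).real (S ∩ φ ⁻¹' {j}) =
        (volume : Measure unitInterval).real S := by
    intro S hS φ hφ hlt
    have h := sum_measureReal_preimage_singleton (μ := (volume : Measure unitInterval).restrict S)
      (Finset.range N) (f := φ) (fun j _ => hφ (measurableSet_singleton j))
    have huniv : φ ⁻¹' (↑(Finset.range N) : Set ℕ) = univ := by
      ext x
      simpa using hlt x
    rw [huniv, measureReal_restrict_apply MeasurableSet.univ, univ_inter] at h
    rw [← h]
    refine Finset.sum_congr rfl fun j _ => ?_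
    rw [measureReal_restrict_apply (hφ (measurableSet_singleton j)), inter_comm]
  refine ⟨fun i j => (volume : Measure unitInterval).real
    (cellIndex N ⁻¹' {i} ∩ (fun x => cellIndex N (f x)) ⁻¹' {j}), fun i j => measureReal_nonneg,
    ?_, ?_, ?_⟩
  · intro i hi
    rw [key _ (hc (measurableSet_singleton i)) _ hcf fun x => cellIndex_lt hN _,
      measureReal_cellIndex_preimage hi]
  · intro j hj
    simp_rw [inter_comm (cellIndex N ⁻¹' _)]
    rw [key _ (hcf (measurableSet_singleton j)) _ hc fun x => cellIndex_lt hN _,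
      ← measureReal_cellIndex_preimage hj, measureReal_def, measureReal_def]
    congr 1
    exact hf _ (hc (measurableSet_singleton j))
  · intro i j hM
    obtain ⟨x, hx⟩ := nonempty_of_measureReal_ne_zero hM.ne'
    exact ⟨x, hx⟩

/-- A smoothed transition matrix, whose rows are supported on intervals of controlled size. -/
theorem exists_smoothTransitionMatrix {f : C(unitInterval, unitInterval)} (hf : MeasPres f)
    {N : ℕ} (hN : 0 < N) {q : ℝ} (hq : 1 ≤ q) {F : ℕ → ℝ}
    (hF : ∀ i < N, ∀ x : unitInterval, (x : ℝ) ∈ gridCell N i → |N * (f x : ℝ) - F i| ≤ q - 1) :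
    ∃ m : ℕ → ℕ → ℝ, (∀ i l, 0 ≤ m i l) ∧ (∀ i < N, ∑ l ∈ Finset.range N, m i l = 1 / N) ∧
      (∀ l < N, ∑ i ∈ Finset.range N, m i l = 1 / N) ∧
      ∀ i < N, (∃ lo hi, hi ≤ N ∧ ∀ l, 0 < m i l ↔ lo ≤ l ∧ l < hi) ∧
        (∀ l < N, |(l : ℝ) - F i| ≤ q → 0 < m i l) ∧
        ∀ l, 0 < m i l → l < N ∧ |(l : ℝ) - F i| ≤ 4 * q := by
  have hN' : (0 : ℝ) < N := by exact_mod_cast hN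
  obtain ⟨M, hM0, hMrow, hMcol, hMpos⟩ := exists_transitionMatrix hf hN
  set R : ℕ := ⌈2 * q⌉₊ with hR
  have hR1 : 2 * q ≤ R := Nat.le_ceil _
  have hR2 : (R : ℝ) ≤ 3 * q := by
    have := Nat.ceil_lt_add_one (by linarith : 0 ≤ 2 * q)
    rw [← hR] at this
    linarith
  obtain ⟨A, hA0, hAsymm, hAsum, hApos⟩ := exists_bandMatrix N R
  have hAcol : ∀ l < N, ∑ j ∈ Finset.range N, A j l = 1 := fun l hl => by
    simpa only [hAsymm _ l] using hAsum l hl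
  have hMF : ∀ i < N, ∀ j, 0 < M i j → |(j : ℝ) - F i| ≤ q := by
    intro i hi j hM
    obtain ⟨x, hxi, hxj⟩ := hMpos i j hM
    have h1 := hF i hi x (hxi ▸ mem_gridCell_cellIndex hN x)
    have h2 := mem_gridCell_cellIndex hN (f x)
    rw [hxj, gridCell, mem_Icc, div_le_iff₀ hN', le_div_iff₀ hN'] at h2
    rw [abs_le] at h1 ⊢
    constructor <;> linarith [h1.1, h1.2, h2.1, h2.2]
  have hMex : ∀ i < N, ∃ j < N, 0 < M i j := by
    intro i hi
    by_contra! hcon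
    have := Finset.sum_nonpos (s := Finset.range N) (f := fun j => M i j)
      fun j hj => hcon j (Finset.mem_range.1 hj)
    rw [hMrow i hi] at this
    exact absurd (one_div_pos.2 hN') this.not_gt
  set m : ℕ → ℕ → ℝ := fun i l => if l < N then ∑ j ∈ Finset.range N, M i j * A j l else 0 with hm
  have hm0 : ∀ i l, 0 ≤ m i l := by
    intro i l
    simp only [hm]
    split_ifs
    exacts [Finset.sum_nonneg fun j _ => mul_nonneg (hM0 i j) (hA0 j l), le_rfl]
  have hmpos : ∀ i l, 0 < m i l ↔ l < N ∧ ∃ j < N, 0 < M i j ∧ j ≤ l + R ∧ l ≤ j + R := by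
    intro i l
    by_cases hl : l < N
    · simp only [hm, hl, if_true, true_and]
      rw [Finset.sum_pos_iff_of_nonneg fun j _ => mul_nonneg (hM0 i j) (hA0 j l)]
      refine exists_congr fun j => ?_
      rw [Finset.mem_range, ← hApos]
      refine and_congr_right fun _ => ⟨fun h => ⟨?_, ?_⟩, fun h => mul_pos h.1 h.2⟩
      · exact pos_of_mul_pos_left h (hA0 j l)
      · exact pos_of_mul_pos_right h (hM0 i j)
    · simp [hm, hl]
  refine ⟨m, hm0, ?_, ?_, fun i hi => ⟨?_, ?_, ?_⟩⟩
  · intro i hi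
    calc ∑ l ∈ Finset.range N, m i l
        = ∑ l ∈ Finset.range N, ∑ j ∈ Finset.range N, M i j * A j l :=
          Finset.sum_congr rfl fun l hl => if_pos (Finset.mem_range.1 hl)
      _ = ∑ j ∈ Finset.range N, M i j := by
          rw [Finset.sum_comm]
          refine Finset.sum_congr rfl fun j hj => ?_
          rw [← Finset.mul_sum, hAsum j (Finset.mem_range.1 hj), mul_one]
      _ = 1 / N := hMrow i hi
  · intro l hl
    simp only [hm, hl, if_true]
    rw [Finset.sum_comm]
    calc ∑ j ∈ Finset.range N, ∑ i ∈ Finset.range N, M i j * A j l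
        = ∑ j ∈ Finset.range N, 1 / N * A j l := by
          refine Finset.sum_congr rfl fun j hj => ?_
          rw [← Finset.sum_mul, hMcol j (Finset.mem_range.1 hj)]
      _ = 1 / N := by rw [← Finset.mul_sum, hAcol l hl, mul_one]
  · set S := (Finset.range N).filter fun l => 0 < m i l with hS
    obtain ⟨j, hj, hMj⟩ := hMex i hi
    have hjS : j ∈ S := by
      rw [hS, Finset.mem_filter, Finset.mem_range, hmpos]
      exact ⟨hj, hj, j, hj, hMj, by omega, by omega⟩
    have hne : S.Nonempty := ⟨j, hjS⟩
    have hmax := S.max'_mem hne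
    have hmin := S.min'_mem hne
    refine ⟨S.min' hne, S.max' hne + 1, ?_, fun l => ⟨fun h => ?_, fun h => ?_⟩⟩
    · exact Finset.mem_range.1 (Finset.mem_filter.1 hmax).1
    · have hl : l ∈ S := Finset.mem_filter.2 ⟨Finset.mem_range.2 ((hmpos i l).1 h).1, h⟩
      exact ⟨S.min'_le l hl, Nat.lt_succ_of_le (S.le_max' l hl)⟩
    · generalize S.min' hne = p at *
      generalize S.max' hne = r at *
      obtain ⟨hp, j₁, hj₁, hM₁, h11, h12⟩ := (hmpos i p).1 (Finset.mem_filter.1 hmin).2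
      obtain ⟨hr, j₂, hj₂, hM₂, h21, h22⟩ := (hmpos i r).1 (Finset.mem_filter.1 hmax).2
      have h1 := abs_le.1 (hMF i hi j₁ hM₁)
      have h2 := abs_le.1 (hMF i hi j₂ hM₂)
      have h12' : j₁ ≤ j₂ + R := by
        have : (j₁ : ℝ) ≤ j₂ + R := by linarith [h1.2, h2.1]
        exact_mod_cast this
      have h21' : j₂ ≤ j₁ + R := by
        have : (j₂ : ℝ) ≤ j₁ + R := by linarith [h1.1, h2.2]
        exact_mod_cast this
      rw [hmpos]
      refine ⟨by omega, ?_⟩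
      by_cases hlj : l ≤ j₁ + R
      · exact ⟨j₁, hj₁, hM₁, by omega, hlj⟩
      · exact ⟨j₂, hj₂, hM₂, by omega, by omega⟩
  · intro l hl hlF
    obtain ⟨j, hj, hMj⟩ := hMex i hi
    have h1 := abs_le.1 (hMF i hi j hMj)
    have h2 := abs_le.1 hlF
    refine (hmpos i l).2 ⟨hl, j, hj, hMj, ?_, ?_⟩
    · have : (j : ℝ) ≤ l + R := by linarith [h1.2, h2.1]
      exact_mod_cast this
    · have : (l : ℝ) ≤ j + R := by linarith [h1.1, h2.2]
      exact_mod_cast this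
  · intro l h
    obtain ⟨hl, j, hj, hMj, hj1, hj2⟩ := (hmpos i l).1 h
    have h1 := abs_le.1 (hMF i hi j hMj)
    have h2 : (j : ℝ) ≤ l + R := by exact_mod_cast hj1
    have h3 : (l : ℝ) ≤ j + R := by exact_mod_cast hj2
    refine ⟨hl, abs_le.2 ⟨?_, ?_⟩⟩ <;> linarith [h1.1, h1.2]

/-- Along punctured neighbourhoods of `p`, the difference quotients of `F` have sign `σ` and
modulus larger than `1`. -/
def ExpandsOnInterval (σ : ℝ) (F : unitInterval → unitInterval) (p : unitInterval) : Prop :=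
  ∀ᶠ y in 𝓝[≠] p, 1 < σ * (((F y : ℝ) - F p) / ((y : ℝ) - p))

/-- `p` is an interior point near which `F` expands distances to `p` and does not fold. -/
def IsRegularAt (F : unitInterval → unitInterval) (p : unitInterval) : Prop :=
  (0 < (p : ℝ) ∧ (p : ℝ) < 1) ∧ ∃ σ : ℝ, (σ = 1 ∨ σ = -1) ∧ ExpandsOnInterval σ F p

theorem ExpandsOnInterval.comp {σ σ' : ℝ} {F G : unitInterval → unitInterval} {p : unitInterval}
    (hF : ExpandsOnInterval σ F (G p)) (hG : ExpandsOnInterval σ' G p) (hc : ContinuousAt G p) :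
    ExpandsOnInterval (σ * σ') (F ∘ G) p := by
  have hne : ∀ᶠ y in 𝓝[≠] p, G y ≠ G p := by
    filter_upwards [hG] with y hy h
    rw [h, sub_self, zero_div, mul_zero] at hy
    exact absurd hy (by norm_num)
  have ht : Tendsto G (𝓝[≠] p) (𝓝[≠] (G p)) :=
    tendsto_nhdsWithin_iff.2 ⟨hc.tendsto.mono_left nhdsWithin_le_nhds, hne⟩
  filter_upwards [hG, ht.eventually hF, hne] with y h1 h2 h3
  have h4 : (G y : ℝ) - G p ≠ 0 := sub_ne_zero.2 fun h => h3 (Subtype.ext h)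
  calc (1 : ℝ) < (σ * (((F (G y) : ℝ) - F (G p)) / ((G y : ℝ) - G p))) *
        (σ' * (((G y : ℝ) - G p) / ((y : ℝ) - p))) := one_lt_mul_of_lt_of_le h2 h1.le
    _ = σ * σ' * ((((F ∘ G) y : ℝ) - (F ∘ G) p) / ((y : ℝ) - p)) := by
        rw [mul_mul_mul_comm, div_mul_div_cancel₀ h4]
        rfl

theorem exists_expandsOnInterval_iterate {g : unitInterval → unitInterval} (hg : Continuous g)
    {p : unitInterval} (n : ℕ) (h : ∀ i ≤ n, IsRegularAt g (g^[i] p)) :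
    ∃ σ : ℝ, (σ = 1 ∨ σ = -1) ∧ ExpandsOnInterval σ g^[n + 1] p := by
  induction n with
  | zero => exact (h 0 le_rfl).2
  | succ n ih =>
    obtain ⟨σ, hσ, hE⟩ := ih fun i hi => h i (by omega)
    obtain ⟨-, σ', hσ', hE'⟩ := h (n + 1) le_rfl
    refine ⟨σ' * σ, ?_, ?_⟩
    · rcases hσ with rfl | rfl <;> rcases hσ' with rfl | rfl <;> norm_num
    · rw [Function.iterate_succ' g (n + 1)]
      exact hE'.comp hE (hg.iterate _).continuousAt

theorem ExpandsOnInterval.transversePt {g : unitInterval → unitInterval} {k : ℕ} {σ : ℝ}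
    {p : unitInterval} (hp : g^[k] p = p) (hp01 : 0 < (p : ℝ) ∧ (p : ℝ) < 1)
    (hσ : σ = 1 ∨ σ = -1) (hE : ExpandsOnInterval σ g^[k] p) : TransversePt g k p := by
  obtain ⟨δ, hδ, hball⟩ := Metric.mem_nhdsWithin_iff.1 hE
  have key : ∀ y : unitInterval, |(y : ℝ) - p| < δ → (y : ℝ) ≠ p →
      1 < σ * (((g^[k] y : ℝ) - p) / ((y : ℝ) - p)) := by
    intro y hy hne
    have h : (y : unitInterval) ∈ ball p δ ∩ {p}ᶜ :=
      ⟨by rwa [mem_ball, Subtype.dist_eq, Real.dist_eq], fun h => hne (congrArg Subtype.val h)⟩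
    have := hball h
    rwa [Set.mem_ofPred_eq, hp] at this
  refine ⟨max (p - δ) 0, p, p, min (p + δ) 1, le_max_right _ _, max_lt (by linarith) hp01.1, le_rfl,
    lt_min (by linarith) hp01.2, min_le_right _ _, le_rfl, le_rfl, ?_, ?_⟩
  · intro x h1 h2
    rw [show x = p from Subtype.ext (le_antisymm h2 h1), hp]
  · have hL : ∀ x : unitInterval, max ((p : ℝ) - δ) 0 < x → (x : ℝ) < p →
        1 < σ * (((g^[k] x : ℝ) - p) / ((x : ℝ) - p)) := fun x h1 h2 => by
      have := (le_max_left _ _).trans_lt h1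
      exact key x (abs_lt.2 ⟨by linarith, by linarith⟩) h2.ne
    have hR : ∀ x : unitInterval, (p : ℝ) < x → (x : ℝ) < min ((p : ℝ) + δ) 1 →
        1 < σ * (((g^[k] x : ℝ) - p) / ((x : ℝ) - p)) := fun x h1 h2 => by
      have := h2.trans_le (min_le_left _ _)
      exact key x (abs_lt.2 ⟨by linarith, by linarith⟩) h1.ne'
    rcases hσ with rfl | rfl
    · right
      refine ⟨fun x h1 h2 => ?_, fun x h1 h2 => ?_⟩
      · have := hL x h1 h2
        rw [one_mul, one_lt_div_of_neg (by linarith)] at this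
        linarith
      · have := hR x h1 h2
        rw [one_mul, one_lt_div (by linarith)] at this
        linarith
    · left
      refine ⟨fun x h1 h2 => ?_, fun x h1 h2 => ?_⟩
      · have := hL x h1 h2
        rw [neg_one_mul, ← neg_div, one_lt_div_of_neg (by linarith)] at this
        linarith
      · have := hR x h1 h2
        rw [neg_one_mul, ← neg_div, one_lt_div (by linarith)] at this
        linarith

/-- If all singular values of `g` lie in `D`, and `D` is mapped into a subset `E` of `D` made of
regular points, then all periodic points of `g` are transverse. -/
theorem transversePt_of_mem_fixSet {g : unitInterval → unitInterval} (hg : Continuous g) {k : ℕ}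
    (hk : 1 ≤ k) {D E : Set unitInterval} (hD : ∀ x, IsRegularAt g x ∨ g x ∈ D) (hED : E ⊆ D)
    (hDE : MapsTo g D E) (hE : ∀ x ∈ E, IsRegularAt g x) {p : unitInterval}
    (hp : p ∈ FixSet g k) : TransversePt g k p := by
  have hp' : g^[k] p = p := hp
  obtain ⟨n, rfl⟩ : ∃ n, k = n + 1 := ⟨k - 1, by omega⟩
  have hreg : ∀ i, IsRegularAt g (g^[i] p) := by
    intro i
    by_contra hcon
    set c := g^[i] p with hc
    have hcD : g c ∈ D := (hD c).resolve_left hcon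
    have hfix : g^[n] (g c) = c := by
      rw [← Function.iterate_succ_apply, hc, ← Function.iterate_add_apply, add_comm,
        Function.iterate_add_apply, hp']
    refine hcon (hE c ?_)
    have hcD' : c ∈ D := by
      rw [← hfix]
      exact (hDE.mono_right hED).iterate n hcD
    have hper : g (g^[n] c) = c := by
      rw [← Function.iterate_succ_apply' g n c, Function.iterate_succ_apply, hfix]
    rw [← hper]
    exact hDE ((hDE.mono_right hED).iterate n hcD')
  obtain ⟨σ, hσ, hexp⟩ := exists_expandsOnInterval_iterate hg n fun i _ => hreg i
  exact hexp.transversePt hp' (hreg 0).1 hσ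

/-- Inverse branches along an itinerary can be composed. -/
theorem exists_itinerary_branch {C : ℕ → Set ℝ} {g : ℝ → ℝ}
    (H : ∀ n, ∃ ψ : ℝ → ℝ, ContinuousOn ψ (C (n + 1)) ∧
      ∀ y ∈ C (n + 1), ψ y ∈ C n ∧ g (ψ y) = y) (n : ℕ) :
    ∃ ψ : ℝ → ℝ, ContinuousOn ψ (C n) ∧
      ∀ y ∈ C n, g^[n] (ψ y) = y ∧ ∀ s ≤ n, g^[s] (ψ y) ∈ C s := by
  induction n with
  | zero =>
    refine ⟨id, continuousOn_id, fun y hy => ⟨rfl, fun s hs => ?_⟩⟩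
    obtain rfl : s = 0 := by omega
    exact hy
  | succ n ih =>
    obtain ⟨φ, hφc, hφ⟩ := ih
    obtain ⟨ψ, hψc, hψ⟩ := H n
    refine ⟨φ ∘ ψ, hφc.comp hψc fun y hy => (hψ y hy).1, fun y hy => ?_⟩
    obtain ⟨hy1, hy2⟩ := hψ y hy
    obtain ⟨h1, h2⟩ := hφ _ hy1
    have h3 : g^[n + 1] (φ (ψ y)) = y := by
      rw [Function.iterate_succ_apply', h1, hy2]
    refine ⟨h3, fun s hs => ?_⟩
    rcases Nat.lt_succ_iff_lt_or_eq.1 (Nat.lt_succ_of_le hs) with hs | rfl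
    · exact h2 s (by omega)
    · rwa [Function.comp_apply, h3]

theorem gridCell_disjoint {N i j : ℕ} (hN : 0 < N) (hij : i + 1 < j ∨ j + 1 < i) {x : ℝ}
    (hi : x ∈ gridCell N i) : x ∉ gridCell N j := by
  have hN' : (0 : ℝ) < N := by exact_mod_cast hN
  intro hj
  rw [gridCell, mem_Icc, div_le_iff₀ hN', le_div_iff₀ hN'] at hi hj
  rcases hij with h | h
  · have : (i : ℝ) + 1 < j := by exact_mod_cast h
    linarith [hi.2, hj.1]
  · have : (j : ℝ) + 1 < i := by exact_mod_cast h
    linarith [hj.2, hi.1]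

/-- A map whose grid cells `i₀, i₀ + 2, …, i₀ + 2 (k - 1)` cover each other has a point of
exact period `k`. -/
theorem exists_periodic_of_branches {g : ℝ → ℝ} {N k i₀ : ℕ} (hN : 0 < N) (hk : 1 ≤ k)
    (H : ∀ s < k, ∀ t < k, ∃ ψ : ℝ → ℝ, ContinuousOn ψ (gridCell N (i₀ + 2 * t)) ∧
      ∀ y ∈ gridCell N (i₀ + 2 * t), ψ y ∈ gridCell N (i₀ + 2 * s) ∧ g (ψ y) = y) :
    ∃ x ∈ gridCell N i₀, g^[k] x = x ∧ ∀ i, 1 ≤ i → i < k → g^[i] x ≠ x := by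
  have hmod : ∀ n, n % k < k := fun n => Nat.mod_lt n hk
  obtain ⟨ψ, hψc, hψ⟩ := exists_itinerary_branch (C := fun n => gridCell N (i₀ + 2 * (n % k)))
    (g := g) (fun n => H _ (hmod n) _ (hmod (n + 1))) k
  simp only [Nat.mod_self, mul_zero, add_zero] at hψc hψ
  have hle : (i₀ : ℝ) / N ≤ ((i₀ : ℝ) + 1) / N := by gcongr; linarith
  have hmaps : MapsTo ψ (gridCell N i₀) (gridCell N i₀) := fun y hy => by
    simpa using (hψ y hy).2 0 (Nat.zero_le k)
  obtain ⟨x, hx, hfix⟩ := exists_mem_Icc_isFixedPt_of_mapsTo hψc hle hmaps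
  obtain ⟨h1, h2⟩ := hψ x hx
  rw [hfix] at h1 h2
  refine ⟨x, hx, h1, fun i hi1 hik heq => ?_⟩
  have := h2 i hik.le
  rw [heq, Nat.mod_eq_of_lt hik] at this
  exact gridCell_disjoint hN (.inl (by omega)) hx this

/-- A concatenation of grid paths over the cells of the uniform grid, through the interior vertices
`u i / N`, whose occupation times add up to Lebesgue measure. -/
structure GridSystem (N : ℕ) (u : ℕ → ℕ) (m : ℕ → ℕ → ℝ) (g : ℝ → ℝ) : Prop where
  pos : 0 < N
  vertex : ∀ i ≤ N, 0 < u i ∧ u i < N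
  path : ∀ i < N, GridPath N ((i : ℝ) / N) (((i : ℝ) + 1) / N) (u i) (u (i + 1)) (-1) (-1) (m i) g
  col : ∀ l < N, ∑ i ∈ Finset.range N, m i l = 1 / N

theorem sum_volume_inter_gridCell {N : ℕ} (hN : 0 < N) (A : Set ℝ) (n : ℕ) :
    ∑ l ∈ Finset.range n, volume (A ∩ gridCell N l) = volume (A ∩ Ioc 0 ((n : ℝ) / N)) := by
  have hN' : (0 : ℝ) < N := by exact_mod_cast hN
  induction n with
  | zero => simp
  | succ n ih =>
    have h0 : (0 : ℝ) ≤ n / N := by positivity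
    have h1 : (n : ℝ) / N ≤ (n + 1 : ℕ) / N := by gcongr; simp
    have h2 : volume (A ∩ gridCell N n) =
        volume (A ∩ Ioc ((n : ℝ) / N) ((n + 1 : ℕ) / N)) := by
      refine measure_congr ((ae_eq_refl A).inter ?_)
      rw [gridCell]
      push_cast
      exact Ioc_ae_eq_Icc.symm
    rw [Finset.sum_range_succ, ih, h2,
      ← measure_inter_add_sdiff (A ∩ Ioc 0 ((n + 1 : ℕ) / N : ℝ)) (measurableSet_Iic (a := (n : ℝ) / N))]
    congr 2 <;> ext x <;> simp only [mem_inter_iff, mem_Ioc, mem_Iic, Set.mem_sdiff, not_le]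
    · constructor
      · rintro ⟨h3, h4, h5⟩
        exact ⟨⟨h3, h4, h5.trans h1⟩, h5⟩
      · rintro ⟨⟨h3, h4, h5⟩, h6⟩
        exact ⟨h3, h4, h6⟩
    · constructor
      · rintro ⟨h3, h4, h5⟩
        exact ⟨⟨h3, h0.trans_lt h4, h5⟩, h4⟩
      · rintro ⟨⟨h3, h4, h5⟩, h6⟩
        exact ⟨h3, h6, h5⟩

namespace GridSystem

variable {N : ℕ} {u : ℕ → ℕ} {m : ℕ → ℕ → ℝ} {g : ℝ → ℝ}

theorem total (H : GridSystem N u m g) :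
    GridPath N 0 1 (u 0) (u N) (-1) (-1) (fun l => ∑ i ∈ Finset.range N, m i l) g := by
  have h := GridPath.concat H.path H.pos le_rfl
  rwa [div_self (Nat.cast_ne_zero.2 H.pos.ne')] at h

theorem mem_Icc (H : GridSystem N u m g) (x : unitInterval) : g x ∈ Icc (0 : ℝ) 1 := by
  obtain ⟨l, hl, -, hx⟩ := H.total.range x x.2
  have hN' : (0 : ℝ) < N := by exact_mod_cast H.pos
  have hl' : (l : ℝ) + 1 ≤ N := by exact_mod_cast hl
  exact ⟨(by positivity : (0 : ℝ) ≤ l / N).trans hx.1, hx.2.trans ((div_le_one hN').2 hl')⟩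

/-- The continuous self-map of the unit interval defined by a grid system. -/
def toMap (H : GridSystem N u m g) : C(unitInterval, unitInterval) where
  toFun x := ⟨g x, H.mem_Icc x⟩
  continuous_toFun := (continuousOn_iff_continuous_domRestrict.1 H.total.cont).subtype_mk _

theorem coe_toMap (H : GridSystem N u m g) (x : unitInterval) : (H.toMap x : ℝ) = g x := rfl

theorem coe_toMap_iterate (H : GridSystem N u m g) (n : ℕ) (x : unitInterval) :
    ((⇑H.toMap)^[n] x : ℝ) = g^[n] x :=
  (Function.Semiconj.iterate_right (f := fun x : unitInterval => (x : ℝ)) (ga := H.toMap) (gb := g)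
    (fun x => H.coe_toMap x) n) x

theorem measPres (H : GridSystem N u m g) : MeasPres H.toMap := by
  intro A _
  have hN' : (0 : ℝ) < N := by exact_mod_cast H.pos
  have h1 : (Subtype.val '' (H.toMap ⁻¹' A) : Set ℝ) = Icc 0 1 ∩ g ⁻¹' (Subtype.val '' A) := by
    ext x
    constructor
    · rintro ⟨y, hy, rfl⟩
      exact ⟨y.2, H.toMap y, hy, rfl⟩
    · rintro ⟨hx, y, hy, hyx⟩
      refine ⟨⟨x, hx⟩, ?_, rfl⟩
      rw [mem_preimage]
      rwa [show H.toMap ⟨x, hx⟩ = y from Subtype.ext hyx.symm]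
  have h2 : (Subtype.val '' A : Set ℝ) = Subtype.val '' A ∩ Icc (0 : ℝ) 1 := by
    refine (inter_eq_left.2 ?_).symm
    rintro _ ⟨y, -, rfl⟩
    exact y.2
  have h3 : (Icc (0 : ℝ) 1 : Set ℝ) =ᵐ[volume] Ioc (0 : ℝ) 1 := Ioc_ae_eq_Icc.symm
  have h4 : volume (Subtype.val '' A : Set ℝ) = volume (Subtype.val '' A ∩ Ioc (0 : ℝ) 1) := by
    conv_lhs => rw [h2]
    exact measure_congr ((ae_eq_refl _).inter h3)
  have h6 : volume (Icc (0 : ℝ) 1 ∩ g ⁻¹' (Subtype.val '' A)) =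
      volume (Ioc (0 : ℝ) 1 ∩ g ⁻¹' (Subtype.val '' A)) := measure_congr (h3.inter (ae_eq_refl _))
  change (volume : Measure unitInterval) _ = (volume : Measure unitInterval) _
  rw [unitInterval.volume_apply, unitInterval.volume_apply, h1, h6, H.total.vol, h4]
  have h5 := sum_volume_inter_gridCell H.pos (Subtype.val '' A) N
  rw [div_self hN'.ne'] at h5
  rw [← h5]
  refine Finset.sum_congr rfl fun l hl => ?_
  rw [H.col l (Finset.mem_range.1 hl), mul_one_div_cancel hN'.ne', ENNReal.ofReal_one, one_mul]

theorem piecewiseAffine (H : GridSystem N u m g) : PiecewiseAffine H.toMap := by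
  obtain ⟨n, t, h0, h1, hlt, haff⟩ := H.total.affine.exists_subdivision
  refine ⟨n, t, h0, h1, hlt, fun j hj => ?_⟩
  obtain ⟨s, c, hsc⟩ := haff j hj
  exact ⟨s, c, fun x hx1 hx2 => hsc x ⟨hx1, hx2⟩⟩

theorem isRegularAt (H : GridSystem N u m g) {x : unitInterval} (hx : 0 < (x : ℝ) ∧ (x : ℝ) < 1)
    (hg : LocallyExpands g x) : IsRegularAt H.toMap x := by
  obtain ⟨σ, hσ, hE⟩ := hg
  refine ⟨hx, σ, hσ, ?_⟩
  have ht : Tendsto (fun y : unitInterval => (y : ℝ)) (𝓝[≠] x) (𝓝[≠] (x : ℝ)) := by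
    refine tendsto_nhdsWithin_iff.2
      ⟨continuous_subtype_val.continuousAt.tendsto.mono_left nhdsWithin_le_nhds, ?_⟩
    filter_upwards [self_mem_nhdsWithin] with y hy h
    exact hy (Subtype.ext h)
  filter_upwards [ht.eventually hE] with y hy
  rwa [slope_def_field] at hy

theorem apply_vertex (H : GridSystem N u m g) {j : ℕ} (hj : j ≤ N) : g ((j : ℝ) / N) = u j / N := by
  rcases hj.lt_or_eq with hj | rfl
  · exact (H.path j hj).left
  · have h := H.total.right
    rwa [div_self (Nat.cast_ne_zero.2 H.pos.ne')]

theorem transversePt (H : GridSystem N u m g) {k : ℕ} (hk : 1 ≤ k) {p : unitInterval}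
    (hp : p ∈ FixSet H.toMap k) : TransversePt H.toMap k p := by
  have hN' : (0 : ℝ) < N := by exact_mod_cast H.pos
  refine transversePt_of_mem_fixSet H.toMap.continuous hk
    (D := {x | ∃ j : ℕ, j ≤ N ∧ (x : ℝ) = j / N})
    (E := {x | ∃ j : ℕ, (0 < j ∧ j < N) ∧ (x : ℝ) = j / N}) ?_ ?_ ?_ ?_ hp
  · intro x
    rcases x.2.1.eq_or_lt with h0 | h0
    · refine .inr ⟨u 0, (H.vertex 0 (Nat.zero_le _)).2.le, ?_⟩
      rw [coe_toMap, ← h0]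
      exact H.total.left
    rcases x.2.2.eq_or_lt with h1 | h1
    · refine .inr ⟨u N, (H.vertex N le_rfl).2.le, ?_⟩
      rw [coe_toMap, h1]
      exact H.total.right
    rcases H.total.inner x ⟨h0, h1⟩ with h | h
    · exact .inl (H.isRegularAt ⟨h0, h1⟩ h)
    · exact .inr h
  · rintro x ⟨j, hj, hx⟩
    exact ⟨j, hj.2.le, hx⟩
  · rintro x ⟨j, hj, hx⟩
    refine ⟨u j, H.vertex j hj, ?_⟩
    rw [coe_toMap, hx]
    exact H.apply_vertex hj
  · rintro x ⟨j, ⟨hj0, hjN⟩, hx⟩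
    have hj0' : (0 : ℝ) < j := by exact_mod_cast hj0
    have hjN' : (j : ℝ) < N := by exact_mod_cast hjN
    refine H.isRegularAt ?_ ?_ <;> rw [hx]
    · exact ⟨div_pos hj0' hN', (div_lt_one hN').2 hjN'⟩
    · obtain ⟨i, rfl⟩ : ∃ i, j = i + 1 := ⟨j - 1, by omega⟩
      have h1 := H.path i (by omega)
      have h2 := H.path (i + 1) hjN
      push_cast at h1 h2 ⊢
      exact h1.locallyExpands_joint h2 (.inr rfl)

theorem perSet_nonempty (H : GridSystem N u m g) {k i₀ : ℕ} (hk : 1 ≤ k) (hi₀ : i₀ + 2 * k ≤ N)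
    (hm : ∀ s < k, ∀ t < k, 0 < m (i₀ + 2 * s) (i₀ + 2 * t)) : (PerSet H.toMap k).Nonempty := by
  obtain ⟨x, hx, hfix, hper⟩ := exists_periodic_of_branches (g := g) (i₀ := i₀) H.pos hk
    fun s hs t ht => (H.path (i₀ + 2 * s) (by omega)).branch _ (hm s hs t ht)
  have hN' : (0 : ℝ) < N := by exact_mod_cast H.pos
  have hi : (i₀ : ℝ) + 1 ≤ N := by exact_mod_cast (by omega : i₀ + 1 ≤ N)
  have hx01 : x ∈ Icc (0 : ℝ) 1 :=
    ⟨(by positivity : (0 : ℝ) ≤ i₀ / N).trans hx.1, hx.2.trans ((div_le_one hN').2 hi)⟩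
  refine ⟨⟨x, hx01⟩, Subtype.ext ?_, fun i hi1 hik heq => hper i hi1 hik ?_⟩
  · rw [coe_toMap_iterate]
    exact hfix
  · rw [← H.coe_toMap_iterate i ⟨x, hx01⟩, heq]

end GridSystem

/-- Every measure-preserving map is uniformly approximated by grid systems containing `k` pairwise
disjoint cells that cover each other. -/
theorem exists_gridSystem {f : C(unitInterval, unitInterval)} (hf : MeasPres f) (k : ℕ) {ε : ℝ}
    (hε : 0 < ε) :
    ∃ (N : ℕ) (u : ℕ → ℕ) (m : ℕ → ℕ → ℝ) (g : ℝ → ℝ) (i₀ : ℕ), GridSystem N u m g ∧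
      i₀ + 2 * k ≤ N ∧ (∀ s < k, ∀ t < k, 0 < m (i₀ + 2 * s) (i₀ + 2 * t)) ∧
      ∀ x : unitInterval, |g x - f x| ≤ ε := by
  set η : ℝ := ε / 10 with hη
  have hη0 : 0 < η := by positivity
  obtain ⟨δ, hδ, hfδ⟩ := Metric.uniformContinuous_iff.1
    (CompactSpace.uniformContinuous_of_continuous f.continuous) η hη0
  have hfδ' : ∀ x y : unitInterval, |(x : ℝ) - y| < δ → |(f x : ℝ) - f y| ≤ η := fun x y h =>
    (hfδ (a := x) (b := y) h).le
  obtain ⟨N, hNlarge⟩ := exists_nat_gt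
    (max (2 * (k : ℝ) + 3) (max ((2 * (k : ℝ) + 3) / η) ((2 * (k : ℝ) + 3) / δ)))
  rw [max_lt_iff, max_lt_iff, div_lt_iff₀ hη0, div_lt_iff₀ hδ] at hNlarge
  obtain ⟨hNk, hNη, hNδ⟩ := hNlarge
  have hNk' : 2 * k + 3 < N := by exact_mod_cast hNk
  have hN : 0 < N := by omega
  have hN' : (0 : ℝ) < N := by exact_mod_cast hN
  have hk0 : (0 : ℝ) ≤ k := k.cast_nonneg
  set P : ℕ → unitInterval := fun i => projIcc (0 : ℝ) 1 zero_le_one ((i : ℝ) / N) with hP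
  have hPval : ∀ i ≤ N, (P i : ℝ) = i / N := fun i hi => by
    have : (i : ℝ) ≤ N := by exact_mod_cast hi
    simp only [hP]
    rw [projIcc_of_mem zero_le_one ⟨by positivity, (div_le_one hN').2 this⟩]
  set F : ℕ → ℝ := fun i => N * (f (P i) : ℝ) with hF
  have hF0 : ∀ i, 0 ≤ F i := fun i => mul_nonneg hN'.le (f (P i)).2.1
  have hFN : ∀ i, F i ≤ N := fun i => mul_le_of_le_one_right hN'.le (f (P i)).2.2
  have hclose : ∀ i ≤ N, ∀ x : unitInterval, |N * (x : ℝ) - i| ≤ 2 * k + 2 →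
      |N * (f x : ℝ) - F i| ≤ N * η := by
    intro i hi x hx
    have h1 : |(x : ℝ) - P i| < δ := by
      have h2 : (x : ℝ) - P i = (N * x - i) / N := by rw [hPval i hi]; field_simp
      rw [h2, abs_div, abs_of_pos hN', div_lt_iff₀ hN']
      linarith
    rw [hF, ← mul_sub, abs_mul, abs_of_pos hN']
    exact mul_le_mul_of_nonneg_left (hfδ' x (P i) h1) hN'.le
  have hcell : ∀ i < N, ∀ x : unitInterval, (x : ℝ) ∈ gridCell N i →
      |N * (f x : ℝ) - F i| ≤ N * η := by
    intro i hi x hx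
    rw [gridCell, mem_Icc, div_le_iff₀ hN', le_div_iff₀ hN'] at hx
    refine hclose i hi.le x (abs_le.2 ⟨?_, ?_⟩) <;> linarith [hx.1, hx.2]
  set q : ℝ := 2 * (N * η) with hq
  obtain ⟨m, hm0, hrow, hcol, hm⟩ := exists_smoothTransitionMatrix hf hN (q := q) (F := F)
    (by linarith) fun i hi x hx => (hcell i hi x hx).trans (by linarith)
  set u : ℕ → ℕ := fun i => min (max ⌊F i⌋₊ 1) (N - 1) with hu
  have hu1 : ∀ i, 0 < u i ∧ u i < N := fun i => by
    simp only [hu]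
    omega
  have hu2 : ∀ i, |(u i : ℝ) - F i| ≤ 2 := by
    intro i
    have h1 := Nat.floor_le (hF0 i)
    have h2 := Nat.lt_floor_add_one (F i)
    have h3 : ⌊F i⌋₊ ≤ N := Nat.floor_le_of_le (hFN i)
    have h4 : u i ≤ ⌊F i⌋₊ + 1 := by simp only [hu]; omega
    have h5 : ⌊F i⌋₊ ≤ u i + 1 := by simp only [hu]; omega
    have h4' : (u i : ℝ) ≤ ⌊F i⌋₊ + 1 := by exact_mod_cast h4
    have h5' : (⌊F i⌋₊ : ℝ) ≤ u i + 1 := by exact_mod_cast h5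
    exact abs_le.2 ⟨by linarith, by linarith⟩
  have hFsucc : ∀ i < N, |F (i + 1) - F i| ≤ N * η := by
    intro i hi
    refine hclose i hi.le (P (i + 1)) ?_
    rw [hPval (i + 1) hi, mul_div_cancel₀ _ hN'.ne']
    push_cast
    rw [add_sub_cancel_left, abs_one]
    linarith
  have hmle : ∀ i < N, ∀ l, N * m i l ≤ 1 := by
    intro i hi l
    rcases (hm0 i l).eq_or_lt with h | h
    · rw [← h, mul_zero]
      exact zero_le_one
    · have := Finset.single_le_sum (f := fun i => m i l) (fun i _ => hm0 i l)
        (Finset.mem_range.2 hi)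
      rw [hcol l ((hm i hi).2.2 l h).1] at this
      calc N * m i l ≤ N * (1 / N) := mul_le_mul_of_nonneg_left this hN'.le
        _ = 1 := mul_one_div_cancel hN'.ne'
  have hroute : ∀ i < N, GridRoute N (u i) (u (i + 1)) (-1) (-1) (m i) := by
    intro i hi
    obtain ⟨⟨lo, hi', hhi, hsupp⟩, hcore, -⟩ := hm i hi
    have hmem : ∀ w : ℕ, 0 < w → w < N → |(w : ℝ) - F i| ≤ N * η + 2 → lo < w ∧ w < hi' := by
      intro w hw0 hwN hw
      rw [abs_le] at hw
      have h1 := (hsupp w).1 (hcore w hwN (abs_le.2 ⟨by linarith, by linarith⟩))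
      have h2 := (hsupp (w - 1)).1 (hcore (w - 1) (by omega)
        (by rw [Nat.cast_pred hw0]; exact abs_le.2 ⟨by linarith, by linarith⟩))
      omega
    have h1 := hmem (u i) (hu1 i).1 (hu1 i).2 ((hu2 i).trans (by linarith))
    have h2 := hmem (u (i + 1)) (hu1 _).1 (hu1 _).2 (by
      have h3 := abs_le.1 (hu2 (i + 1))
      have h4 := abs_le.1 (hFsucc i hi)
      exact abs_le.2 ⟨by linarith, by linarith⟩)
    refine GridRoute.of_support h1.1 h1.2 h2.1 h2.2 hhi (fun l hl1 hl2 => (hsupp l).2 ⟨hl1, hl2⟩)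
      (hmle i hi) fun l hl => ?_
    exact le_antisymm (not_lt.1 fun h => hl ((hsupp l).1 h)) (hm0 i l)
  obtain ⟨g, hg⟩ := GridPath.exists_concat hN hrow hroute
  obtain ⟨z, -, hz⟩ := exists_mem_Icc_isFixedPt_of_mapsTo (a := (0 : unitInterval)) (b := 1)
    f.continuous.continuousOn zero_le_one fun x _ => ⟨(f x).2.1, (f x).2.2⟩
  have hNz : 0 ≤ N * (z : ℝ) := mul_nonneg hN'.le z.2.1
  have hNz' : N * (z : ℝ) ≤ N := mul_le_of_le_one_right hN'.le z.2.2
  set i₀ : ℕ := min ⌊N * (z : ℝ)⌋₊ (N - 2 * k) with hi₀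
  have hi₀N : i₀ + 2 * k ≤ N := by omega
  have hnear : ∀ s < k, |N * (z : ℝ) - (i₀ + 2 * s : ℕ)| ≤ 2 * k + 1 := by
    intro s hs
    have h1 := Nat.floor_le hNz
    have h2 := Nat.lt_floor_add_one (N * (z : ℝ))
    have h3 : ⌊N * (z : ℝ)⌋₊ ≤ N := Nat.floor_le_of_le hNz'
    have h4 : i₀ + 2 * s ≤ ⌊N * (z : ℝ)⌋₊ + 2 * k := by omega
    have h5 : ⌊N * (z : ℝ)⌋₊ ≤ i₀ + 2 * s + 2 * k := by omega
    have h4' : ((i₀ + 2 * s : ℕ) : ℝ) ≤ ⌊N * (z : ℝ)⌋₊ + 2 * k := by exact_mod_cast h4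
    have h5' : (⌊N * (z : ℝ)⌋₊ : ℝ) ≤ (i₀ + 2 * s : ℕ) + 2 * k := by exact_mod_cast h5
    exact abs_le.2 ⟨by linarith, by linarith⟩
  refine ⟨N, u, m, g, i₀, ⟨hN, fun i _ => hu1 i, hg, hcol⟩, hi₀N, ?_, ?_⟩
  · intro s hs t ht
    refine (hm _ (by omega)).2.1 _ (by omega) ?_
    have h1 := hclose (i₀ + 2 * s) (by omega) z ((hnear s hs).trans (by linarith))
    rw [show f z = z from hz] at h1
    have h2 := abs_le.1 (hnear t ht)
    rw [abs_le] at h1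
    exact abs_le.2 ⟨by linarith, by linarith⟩
  · intro x
    have hi := cellIndex_lt hN x
    have hxc := mem_gridCell_cellIndex hN x
    obtain ⟨l, -, hml, hgl⟩ := (hg _ hi).range x hxc
    have h1 := abs_le.1 (hcell _ hi x hxc)
    have h2 := abs_le.1 ((hm _ hi).2.2 l hml).2
    rw [gridCell, mem_Icc, div_le_iff₀ hN', le_div_iff₀ hN'] at hgl
    have h3 : N * |g x - f x| ≤ N * ε := by
      rw [← abs_of_pos hN', ← abs_mul, abs_of_pos hN', mul_sub]
      have : N * ε = 10 * (N * η) := by rw [hη]; ring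
      rw [this]
      exact abs_le.2 ⟨by linarith [hgl.1], by linarith [hgl.2]⟩
    exact le_of_mul_le_mul_left h3 hN'

theorem dense_piecewiseAffine_transverse (k : ℕ) (hk : 1 ≤ k) :
    Dense {g : ↥CLam |
      PiecewiseAffine g.1 ∧ (PerSet (⇑g.1) k).Nonempty ∧
      ∀ p ∈ FixSet (⇑g.1) k, TransversePt (⇑g.1) k p} := by
  rw [Metric.dense_iff]
  rintro ⟨f, hf⟩ ε hε
  obtain ⟨N, u, m, g, i₀, H, hi₀, hm, hclose⟩ := exists_gridSystem hf k (half_pos hε)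
  refine ⟨⟨H.toMap, H.measPres⟩, ?_, H.piecewiseAffine, H.perSet_nonempty hk hi₀ hm,
    fun p hp => H.transversePt hk hp⟩
  rw [mem_ball, Subtype.dist_eq]
  refine lt_of_le_of_lt ?_ (half_lt_self hε)
  exact (ContinuousMap.dist_le (half_pos hε).le).2 hclose
end
end
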